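/- Let f satisfy (H) be a singular nonlinearity (a_f < ∞) with 0 < τ₊ < 2, where τ₊ := limsup_{t→a_f} f(t)f''(t)/f'(t)², and let (u_m) be a sequence of semistable solutions of (N_{λ_m}) on a smooth bounded domain Ω ⊂ ℝⁿ. Then sup_m ‖u_m‖_{L^∞(Ω)} < a_f whenever n < 8/τ₊. -/

import Mathlib

open MeasureTheory Filter Topology Real Set

noncomputable section

/-- The Laplacian of a real-valued function on Euclidean space. -/
def lap {n : ℕ} (u : EuclideanSpace ℝ (Fin n) → ℝ) (x : EuclideanSpace ℝ (Fin n)) : ℝ :=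
  ∑ i : Fin n, iteratedFDeriv ℝ 2 u x ![EuclideanSpace.single i (1:ℝ), EuclideanSpace.single i (1:ℝ)]

/-- A bounded (smooth) domain. -/
def GoodDomain {n : ℕ} (Ω : Set (EuclideanSpace ℝ (Fin n))) : Prop :=
  IsOpen Ω ∧ Bornology.IsBounded Ω ∧ Ω.Nonempty

/-- The domain `[0, a_f)` of the nonlinearity. -/
def domf (a : EReal) : Set ℝ := {t : ℝ | 0 ≤ t ∧ (t : EReal) < a}

/-- The filter of `t → a_f⁻`. -/
def afFilter (a : EReal) : Filter ℝ :=
  if a = ⊤ then Filter.atTop else nhdsWithin a.toReal (Set.Iio a.toReal)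

/-- Hypothesis (H) on the nonlinearity `f : [0, a_f) → ℝ₊`. -/
structure HypH (a : EReal) (f : ℝ → ℝ) : Prop where
  a_pos : 0 < a
  smooth : ContDiffOn ℝ (⊤ : ℕ∞) f (domf a)
  mono : StrictMonoOn f (domf a)
  convex : ConvexOn ℝ (domf a) f
  f0_pos : 0 < f 0
  pos : ∀ t ∈ domf a, 0 < f t
  blowup : Filter.Tendsto f (afFilter a) Filter.atTop
  superlinear : a = ⊤ → Filter.Tendsto (fun t => f t / t) Filter.atTop Filter.atTop

/-- `τ₋ = liminf_{t → a_f} f f'' / (f')²`. -/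
def tauMinus (a : EReal) (f : ℝ → ℝ) : ℝ :=
  Filter.liminf (fun t => f t * deriv (deriv f) t / (deriv f t) ^ 2) (afFilter a)

/-- `τ₊ = limsup_{t → a_f} f f'' / (f')²`. -/
def tauPlus (a : EReal) (f : ℝ → ℝ) : ℝ :=
  Filter.limsup (fun t => f t * deriv (deriv f) t / (deriv f t) ^ 2) (afFilter a)

/-- `u` is a (smooth, `[0,a_f)`-valued) solution of `Δ²u = λ f(u)` in `Ω`,
`u = Δu = 0` on `∂Ω`. -/
def Solves {n : ℕ} (Ω : Set (EuclideanSpace ℝ (Fin n))) (a : EReal) (lam : ℝ)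
    (f : ℝ → ℝ) (u : EuclideanSpace ℝ (Fin n) → ℝ) : Prop :=
  ContDiff ℝ (⊤ : ℕ∞) u ∧ (∀ x ∈ Ω, 0 ≤ u x ∧ (u x : EReal) < a) ∧
  (∀ x ∈ Ω, lap (lap u) x = lam * f (u x)) ∧
  (∀ x ∈ frontier Ω, u x = 0) ∧ (∀ x ∈ frontier Ω, lap u x = 0)

/-- `u` is a semistable solution: the second variation is nonnegative over
test functions in `H² ∩ H¹₀` (modelled by smooth functions vanishing on `∂Ω`). -/
def Semistable {n : ℕ} (Ω : Set (EuclideanSpace ℝ (Fin n))) (lam : ℝ)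
    (f : ℝ → ℝ) (u : EuclideanSpace ℝ (Fin n) → ℝ) : Prop :=
  ∀ φ : EuclideanSpace ℝ (Fin n) → ℝ, ContDiff ℝ (⊤ : ℕ∞) φ → (∀ x ∈ frontier Ω, φ x = 0) →
    0 ≤ ∫ x in Ω, ((lap φ x) ^ 2 - lam * deriv f (u x) * (φ x) ^ 2)

/-- `u` satisfies the stability inequality
`√λ ∫ √(f'(u)) φ² ≤ ∫ |∇φ|²` for all `φ ∈ H¹₀(Ω)`
(modelled by smooth compactly supported test functions). -/
def StabIneq {n : ℕ} (Ω : Set (EuclideanSpace ℝ (Fin n))) (lam : ℝ)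
    (f : ℝ → ℝ) (u : EuclideanSpace ℝ (Fin n) → ℝ) : Prop :=
  ∀ φ : EuclideanSpace ℝ (Fin n) → ℝ, ContDiff ℝ (⊤ : ℕ∞) φ → HasCompactSupport φ →
    tsupport φ ⊆ Ω →
    Real.sqrt lam * ∫ x in Ω, Real.sqrt (deriv f (u x)) * (φ x) ^ 2 ≤
      ∫ x in Ω, ‖gradient φ x‖ ^ 2

/-- The quartic polynomial `P_f(α, τ₋, τ₊)`. -/
def Pf (τm τp α : ℝ) : ℝ :=
  (2 - τm) ^ 2 * α ^ 4 - 8 * (2 - τp) * α ^ 2 + 4 * (4 - 3 * τp) * α - 4 * (1 - τp)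

/-- `F(t) = ∫₀ᵗ f(s) ds`. -/
def Fint (f : ℝ → ℝ) (t : ℝ) : ℝ := ∫ s in (0:ℝ)..t, f s

/-- `f̃(t) = f(t) - f(0)`. -/
def ftil (f : ℝ → ℝ) (t : ℝ) : ℝ := f t - f 0

/-- `Θ(t) = ∫₀ᵗ θ'(s)² ds`. -/
def Theta (θ : ℝ → ℝ) (t : ℝ) : ℝ := ∫ s in (0:ℝ)..t, (deriv θ s) ^ 2

/-- Partial derivative. -/
def pd {n : ℕ} (i : Fin n) (g : EuclideanSpace ℝ (Fin n) → ℝ) (x : EuclideanSpace ℝ (Fin n)) : ℝ :=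
  fderiv ℝ g x (EuclideanSpace.single i (1:ℝ))

/-- Squared norm of the gradient. -/
def gsq {n : ℕ} (g : EuclideanSpace ℝ (Fin n) → ℝ) (x : EuclideanSpace ℝ (Fin n)) : ℝ :=
  ∑ i, (pd i g x) ^ 2

lemma gsq_nonneg {n : ℕ} (g : EuclideanSpace ℝ (Fin n) → ℝ) (x) : 0 ≤ gsq g x :=
  Finset.sum_nonneg fun _ _ => sq_nonneg _

lemma lap_eq {n : ℕ} {g : EuclideanSpace ℝ (Fin n) → ℝ} {x} (hg : ContDiffAt ℝ 2 g x) :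
    lap g x = ∑ i, pd i (pd i g) x := by
  unfold lap
  refine Finset.sum_congr rfl fun i _ => ?_
  have hd : DifferentiableAt ℝ (fderiv ℝ g) x :=
    (hg.fderiv_right (m := 1) (by norm_num)).differentiableAt (by norm_num)
  rw [iteratedFDeriv_two_apply]
  unfold pd
  rw [fderiv_clm_apply hd (differentiableAt_const _)]
  simp

lemma lap_congr {n : ℕ} {g h : EuclideanSpace ℝ (Fin n) → ℝ} {x} (hgh : g =ᶠ[𝓝 x] h) :
    lap g x = lap h x := by
  unfold lap
  refine Finset.sum_congr rfl fun i _ => ?_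
  rw [(hgh.iteratedFDeriv ℝ 2).eq_of_nhds]

lemma pd_congr {n : ℕ} {i : Fin n} {g h : EuclideanSpace ℝ (Fin n) → ℝ} {x} (hgh : g =ᶠ[𝓝 x] h) :
    pd i g x = pd i h x := by
  unfold pd
  rw [hgh.fderiv_eq]

lemma contDiff_pd {n : ℕ} {i : Fin n} {g : EuclideanSpace ℝ (Fin n) → ℝ}
    (hg : ContDiff ℝ (⊤ : ℕ∞) g) : ContDiff ℝ (⊤ : ℕ∞) (pd i g) := by
  unfold pd
  have : ContDiff ℝ (⊤ : ℕ∞) (fderiv ℝ g) := hg.fderiv_right (by norm_num)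
  exact this.clm_apply contDiff_const

lemma two_le_top : (2 : WithTop ℕ∞) ≤ ((⊤ : ℕ∞) : WithTop ℕ∞) := by
  have : ((2 : ℕ∞) : WithTop ℕ∞) ≤ ((⊤ : ℕ∞) : WithTop ℕ∞) := WithTop.coe_le_coe.2 le_top
  exact this

lemma one_le_top' : (1 : WithTop ℕ∞) ≤ ((⊤ : ℕ∞) : WithTop ℕ∞) := by
  exact_mod_cast (le_top : (1 : ℕ∞) ≤ ⊤)

lemma top_ne_zero' : ((⊤ : ℕ∞) : WithTop ℕ∞) ≠ 0 := by
  exact_mod_cast (ENat.top_ne_zero)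

lemma lap_eq' {n : ℕ} {g : EuclideanSpace ℝ (Fin n) → ℝ} (hg : ContDiff ℝ (⊤ : ℕ∞) g) (x) :
    lap g x = ∑ i, pd i (pd i g) x :=
  lap_eq (hg.contDiffAt.of_le two_le_top)

lemma contDiff_lap {n : ℕ} {g : EuclideanSpace ℝ (Fin n) → ℝ}
    (hg : ContDiff ℝ (⊤ : ℕ∞) g) : ContDiff ℝ (⊤ : ℕ∞) (lap g) := by
  have : lap g = fun x => ∑ i, pd i (pd i g) x := funext (lap_eq' hg)
  rw [this]
  exact ContDiff.sum fun i _ => contDiff_pd (contDiff_pd hg)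

lemma pd_comp {n : ℕ} {i : Fin n} {w : EuclideanSpace ℝ (Fin n) → ℝ} {Θ : ℝ → ℝ} {x}
    (hΘ : DifferentiableAt ℝ Θ (w x)) (hw : DifferentiableAt ℝ w x) :
    pd i (fun y => Θ (w y)) x = deriv Θ (w x) * pd i w x := by
  unfold pd
  have := (hΘ.hasDerivAt.comp_hasFDerivAt x hw.hasFDerivAt).fderiv
  have e : (fun y => Θ (w y)) = Θ ∘ w := rfl
  rw [e, this]
  simp

lemma lap_comp {n : ℕ} {w : EuclideanSpace ℝ (Fin n) → ℝ} {Θ : ℝ → ℝ} {x}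
    (hΘ : ContDiffAt ℝ 2 Θ (w x)) (hw : ContDiffAt ℝ 2 w x) :
    lap (fun y => Θ (w y)) x = deriv (deriv Θ) (w x) * gsq w x + deriv Θ (w x) * lap w x := by
  have hc : ContDiffAt ℝ 2 (fun y => Θ (w y)) x := hΘ.comp x hw
  rw [lap_eq hc, lap_eq hw, gsq, Finset.mul_sum, Finset.mul_sum, ← Finset.sum_add_distrib]
  refine Finset.sum_congr rfl fun i _ => ?_
  have hev : pd i (fun y => Θ (w y)) =ᶠ[𝓝 x] fun y => deriv Θ (w y) * pd i w y := by
    have h1 := hΘ.eventually (by norm_num)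
    have h2 := hw.continuousAt.eventually h1
    have h3 := hw.eventually (by norm_num)
    filter_upwards [h2, h3] with y hy1 hy2
    exact pd_comp (hy1.differentiableAt (by norm_num)) (hy2.differentiableAt (by norm_num))
  rw [pd_congr hev]
  have hdΘ : ContDiffAt ℝ 1 (deriv Θ) (w x) := by
    have : ContDiffAt ℝ 1 (fderiv ℝ Θ) (w x) := hΘ.fderiv_right (by norm_num)
    have h2 : ContDiffAt ℝ 1 (fun t => fderiv ℝ Θ t 1) (w x) := this.clm_apply contDiffAt_const
    simpa using h2
  have hdw : DifferentiableAt ℝ (pd i w) x := by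
    have : ContDiffAt ℝ 1 (fderiv ℝ w) x := hw.fderiv_right (by norm_num)
    exact (this.clm_apply contDiffAt_const).differentiableAt (by norm_num)
  have hcomp : DifferentiableAt ℝ (fun y => deriv Θ (w y)) x :=
    (hdΘ.differentiableAt (by norm_num)).comp x (hw.differentiableAt (by norm_num))
  have hm : pd i (fun y => deriv Θ (w y) * pd i w y) x
      = deriv Θ (w x) * pd i (pd i w) x + pd i w x * pd i (fun y => deriv Θ (w y)) x := by
    conv_lhs => unfold pd
    have := fderiv_mul hcomp hdw
    have e : (fun y => deriv Θ (w y) * pd i w y) = (fun y => deriv Θ (w y)) * pd i w := rfl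
    change fderiv ℝ (fun y => deriv Θ (w y) * pd i w y) x _ = _
    rw [e, this]
    simp [pd]
  rw [hm, pd_comp (hdΘ.differentiableAt (by norm_num)) (hw.differentiableAt (by norm_num))]
  ring

lemma lap_nonpos_of_isLocalMax {n : ℕ} {g : EuclideanSpace ℝ (Fin n) → ℝ} {x}
    (hg : ContDiffAt ℝ 2 g x) (hmax : IsLocalMax g x) : lap g x ≤ 0 := by
  rw [lap_eq hg]
  refine Finset.sum_nonpos fun i _ => ?_
  by_contra hpos
  push Not at hpos
  set e : EuclideanSpace ℝ (Fin n) := EuclideanSpace.single i (1:ℝ) with he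
  set L : ℝ → EuclideanSpace ℝ (Fin n) := fun t => x + t • e with hL
  have hLd : ∀ t, HasDerivAt L e t := by
    intro t
    have := ((hasDerivAt_id t).smul_const e).const_add x
    simpa [hL] using this
  have hL0 : L 0 = x := by simp [hL]
  have hLc : Tendsto L (𝓝 0) (𝓝 x) := by
    have := (hLd 0).continuousAt
    rwa [ContinuousAt, hL0] at this
  have hev := hLc.eventually (hg.eventually (by norm_num))
  have hder : ∀ᶠ t in 𝓝 (0:ℝ), HasDerivAt (fun t => g (L t)) (pd i g (L t)) t := by
    filter_upwards [hev] with t ht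
    exact (ht.differentiableAt (by norm_num)).hasFDerivAt.comp_hasDerivAt t (hLd t)
  have hd1 : deriv (fun t => g (L t)) =ᶠ[𝓝 0] fun t => pd i g (L t) := by
    filter_upwards [hder] with t ht using ht.deriv
  have hdw : DifferentiableAt ℝ (pd i g) x := by
    have : ContDiffAt ℝ 1 (fderiv ℝ g) x := hg.fderiv_right (by norm_num)
    exact (this.clm_apply contDiffAt_const).differentiableAt (by norm_num)
  have hd2 : HasDerivAt (fun t => pd i g (L t)) (pd i (pd i g) x) 0 := by
    have h := hdw
    rw [← hL0] at h
    have := h.hasFDerivAt.comp_hasDerivAt (0:ℝ) (hLd 0)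
    rw [hL0] at this
    exact this
  have hlm : IsLocalMax (fun t => g (L t)) 0 := by
    have : ∀ᶠ y in 𝓝 x, g y ≤ g x := hmax
    have h2 := hLc.eventually this
    filter_upwards [h2] with t ht
    simpa [hL0] using ht
  have hmin : IsLocalMin (fun t => g (L t)) 0 := by
    apply isLocalMin_of_deriv_deriv_pos
    · rw [hd1.deriv_eq, hd2.deriv]; exact hpos
    · exact hlm.deriv_eq_zero
    · exact hder.self_of_nhds.continuousAt
  have hconst : (fun t => g (L t)) =ᶠ[𝓝 0] fun _ => g (L 0) := by
    filter_upwards [hlm, hmin] with t h1 h2 using le_antisymm h1 h2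
  have h0 : deriv (fun t => g (L t)) =ᶠ[𝓝 0] fun _ => 0 := by
    have := hconst.deriv
    simpa using this
  have : (fun t => pd i g (L t)) =ᶠ[𝓝 0] fun _ => (0:ℝ) := hd1.symm.trans h0
  have h3 := this.deriv_eq
  rw [hd2.deriv] at h3
  simp at h3
  rw [h3] at hpos
  exact lt_irrefl _ hpos

lemma ibp1 {n : ℕ} (i : Fin n) {p q : EuclideanSpace ℝ (Fin n) → ℝ}
    (hp : ContDiff ℝ (⊤ : ℕ∞) p) (hq : ContDiff ℝ (⊤ : ℕ∞) q) (hc : HasCompactSupport p) :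
    ∫ x, p x * pd i q x = - ∫ x, pd i p x * q x := by
  have hpc : HasCompactSupport (pd i p) := hc.fderiv_apply (𝕜 := ℝ) _
  have c1 := (contDiff_pd (i := i) hp).continuous
  have c2 := (contDiff_pd (i := i) hq).continuous
  apply integral_mul_fderiv_eq_neg_fderiv_mul_of_integrable
  · exact (c1.mul hq.continuous).integrable_of_hasCompactSupport hpc.mul_right
  · exact (hp.continuous.mul c2).integrable_of_hasCompactSupport hc.mul_right
  · exact (hp.continuous.mul hq.continuous).integrable_of_hasCompactSupport hc.mul_right
  · exact fun x _ => hp.differentiable (by simp) x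
  · exact fun x _ => hq.differentiable (by simp) x

lemma ibp_grad {n : ℕ} {p q : EuclideanSpace ℝ (Fin n) → ℝ}
    (hp : ContDiff ℝ (⊤ : ℕ∞) p) (hq : ContDiff ℝ (⊤ : ℕ∞) q) (hc : HasCompactSupport p) :
    ∫ x, p x * lap q x = - ∫ x, ∑ i, pd i p x * pd i q x := by
  have e : (fun x => p x * lap q x) = fun x => ∑ i, p x * pd i (pd i q) x := by
    funext x; rw [lap_eq' hq, Finset.mul_sum]
  rw [e, integral_finsetSum, integral_finsetSum, ← Finset.sum_neg_distrib]
  · exact Finset.sum_congr rfl fun i _ => ibp1 i hp (contDiff_pd hq) hc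
  · intro i _
    have hpc : HasCompactSupport (pd i p) := hc.fderiv_apply (𝕜 := ℝ) _
    exact ((contDiff_pd hp).continuous.mul
      (contDiff_pd hq).continuous).integrable_of_hasCompactSupport hpc.mul_right
  · intro i _
    exact (hp.continuous.mul
      (contDiff_pd (contDiff_pd hq)).continuous).integrable_of_hasCompactSupport hc.mul_right

lemma ibp_lap {n : ℕ} {p q : EuclideanSpace ℝ (Fin n) → ℝ}
    (hp : ContDiff ℝ (⊤ : ℕ∞) p) (hq : ContDiff ℝ (⊤ : ℕ∞) q) (hc : HasCompactSupport p) :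
    ∫ x, p x * lap q x = ∫ x, lap p x * q x := by
  rw [ibp_grad hp hq hc]
  have e : (fun x => lap p x * q x) = fun x => ∑ i, pd i (pd i p) x * q x := by
    funext x; rw [lap_eq' hp, Finset.sum_mul]
  have hpc : ∀ i, HasCompactSupport (pd i p) := fun i => hc.fderiv_apply (𝕜 := ℝ) _
  rw [e, integral_finsetSum, integral_finsetSum, ← Finset.sum_neg_distrib]
  · refine Finset.sum_congr rfl fun i _ => ?_
    rw [ibp1 i (contDiff_pd hp) hq (hpc i), neg_neg]
  · intro i _
    have hpc' : HasCompactSupport (pd i (pd i p)) := (hpc i).fderiv_apply (𝕜 := ℝ) _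
    exact ((contDiff_pd (contDiff_pd hp)).continuous.mul
      hq.continuous).integrable_of_hasCompactSupport hpc'.mul_right
  · intro i _
    exact ((contDiff_pd hp).continuous.mul
      (contDiff_pd hq).continuous).integrable_of_hasCompactSupport (hpc i).mul_right

/-- Convex smooth cutoff. -/
lemma exists_cutoff (δ : ℝ) (hδ : 0 < δ) : ∃ η : ℝ → ℝ, ContDiff ℝ (⊤ : ℕ∞) η ∧
    (∀ s, s ≤ δ → η s = 0) ∧ (∀ s, 0 ≤ deriv η s) ∧ (∀ s, deriv η s ≤ 1) ∧
    (∀ s, 0 ≤ deriv (deriv η) s) ∧ (∀ s, 0 ≤ η s) ∧ (∀ s, 0 ≤ s → s - 2 * δ ≤ η s) ∧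
    (∀ s, 2 * δ ≤ s → deriv η s = 1) ∧ (∀ s, 0 ≤ s → η s ≤ s) := by
  set S : ℝ → ℝ := fun r => Real.smoothTransition (r / δ - 1) with hS
  have hSc : ContDiff ℝ (⊤ : ℕ∞) S :=
    Real.smoothTransition.contDiff.comp ((contDiff_id.div_const δ).sub contDiff_const)
  have hScont := hSc.continuous
  have hder : ∀ s, HasDerivAt (fun s => ∫ r in (0:ℝ)..s, S r) (S s) s := fun s =>
    intervalIntegral.integral_hasDerivAt_right (hScont.intervalIntegrable _ _)
      hScont.aestronglyMeasurable.stronglyMeasurableAtFilter hScont.continuousAt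
  have hd : deriv (fun s => ∫ r in (0:ℝ)..s, S r) = S := funext fun s => (hder s).deriv
  have hSmono : Monotone S := fun x y hxy => Real.smoothTransition.monotone (by gcongr)
  have hS0 : ∀ s, s ≤ δ → S s = 0 := fun s hs => by
    apply Real.smoothTransition.zero_of_nonpos
    have : s / δ ≤ 1 := (div_le_one hδ).2 hs
    linarith
  have hS1 : ∀ s, 2 * δ ≤ s → S s = 1 := fun s hs => by
    apply Real.smoothTransition.one_of_one_le
    have : 2 ≤ s / δ := (le_div_iff₀ hδ).2 hs
    linarith
  have hSle : ∀ s, S s ≤ 1 := fun s => Real.smoothTransition.le_one _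
  have hSnn : ∀ s, 0 ≤ S s := fun s => Real.smoothTransition.nonneg _
  have hη0 : ∀ s, s ≤ δ → (∫ r in (0:ℝ)..s, S r) = 0 := by
    intro s hs
    have : ∀ r ∈ Set.uIcc 0 s, S r = 0 := by
      intro r hr
      apply hS0
      rcases Set.mem_uIcc.1 hr with h | h <;> linarith [h.1, h.2]
    rw [intervalIntegral.integral_congr (g := fun _ => (0:ℝ)) this]
    simp
  have hηmono : Monotone (fun s => ∫ r in (0:ℝ)..s, S r) :=
    monotone_of_deriv_nonneg (fun s => (hder s).differentiableAt) (by rw [hd]; exact hSnn)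
  have hnn : ∀ s, 0 ≤ ∫ r in (0:ℝ)..s, S r := by
    intro s
    rcases le_total s δ with h | h
    · rw [hη0 s h]
    · have := hηmono h
      simp only [hη0 δ le_rfl] at this
      exact this
  have hanti : Antitone (fun s => (∫ r in (0:ℝ)..s, S r) - s) := by
    apply antitone_of_deriv_nonpos
    · exact fun s => ((hder s).sub (hasDerivAt_id s)).differentiableAt
    · intro s
      rw [((hder s).fun_sub (hasDerivAt_id' s)).deriv]
      linarith [hSle s]
  refine ⟨fun s => ∫ r in (0:ℝ)..s, S r, ?_, hη0, ?_, ?_, ?_, hnn, ?_, ?_, ?_⟩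
  · rw [contDiff_infty_iff_deriv, hd]
    exact ⟨fun s => (hder s).differentiableAt, hSc⟩
  · rw [hd]; exact hSnn
  · rw [hd]; exact hSle
  · rw [hd]; exact fun s => hSmono.deriv_nonneg
  · intro s hs
    rcases le_total s (2 * δ) with h | h
    · linarith [hnn s]
    · have hm : MonotoneOn (fun s => (∫ r in (0:ℝ)..s, S r) - s) (Set.Ici (2 * δ)) := by
        apply monotoneOn_of_deriv_nonneg (convex_Ici _)
        · exact fun s _ => ((hder s).sub (hasDerivAt_id s)).continuousAt.continuousWithinAt
        · exact fun s _ => ((hder s).sub (hasDerivAt_id s)).differentiableAt.differentiableWithinAt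
        · intro s hs
          rw [interior_Ici] at hs
          rw [((hder s).fun_sub (hasDerivAt_id' s)).deriv, hS1 s (le_of_lt hs)]
          simp
      have := hm (Set.mem_Ici.2 le_rfl) (Set.mem_Ici.2 h) h
      simp only at this
      linarith [hnn (2 * δ)]
  · rw [hd]; exact hS1
  · intro s hs
    have := hanti hs
    simp at this
    linarith

/-- Indicator cut off: a function smooth in an open set and vanishing off a compact subset. -/
lemma contDiff_indicator {n : ℕ} {Ω K : Set (EuclideanSpace ℝ (Fin n))} (hΩ : IsOpen Ω)
    (hK : IsCompact K) (hKΩ : K ⊆ Ω) {g : EuclideanSpace ℝ (Fin n) → ℝ}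
    (hg : ∀ x ∈ Ω, ContDiffAt ℝ (⊤ : ℕ∞) g x) (h0 : ∀ x ∈ Ω, x ∉ K → g x = 0) :
    ContDiff ℝ (⊤ : ℕ∞) (Ω.indicator g) ∧ HasCompactSupport (Ω.indicator g) := by
  constructor
  · rw [contDiff_iff_contDiffAt]
    intro x
    by_cases hx : x ∈ Ω
    · refine (hg x hx).congr_of_eventuallyEq ?_
      filter_upwards [hΩ.mem_nhds hx] with y hy
      exact Set.indicator_of_mem hy g
    · have hxK : x ∈ Kᶜ := fun h => hx (hKΩ h)
      refine (contDiffAt_const (c := (0:ℝ))).congr_of_eventuallyEq ?_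
      filter_upwards [hK.isClosed.isOpen_compl.mem_nhds hxK] with y hy
      by_cases hy2 : y ∈ Ω
      · rw [Set.indicator_of_mem hy2, h0 y hy2 hy]
      · exact Set.indicator_of_notMem hy2 g
  · apply HasCompactSupport.intro hK
    intro x hx
    by_cases hy2 : x ∈ Ω
    · rw [Set.indicator_of_mem hy2, h0 x hy2 hx]
    · exact Set.indicator_of_notMem hy2 g

/-- The superlevel sets of a function vanishing at the boundary are compact subsets. -/
lemma isCompact_superlevel {n : ℕ} {Ω : Set (EuclideanSpace ℝ (Fin n))}
    (hb : Bornology.IsBounded Ω) {w : EuclideanSpace ℝ (Fin n) → ℝ}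
    (hw : ContinuousOn w (closure Ω)) {δ : ℝ} (h0 : ∀ x ∈ closure Ω, x ∉ Ω → w x < δ) :
    IsCompact {x | x ∈ closure Ω ∧ δ ≤ w x} ∧ {x | x ∈ closure Ω ∧ δ ≤ w x} ⊆ Ω := by
  constructor
  · have hc : IsCompact (closure Ω) := hb.isCompact_closure
    have : IsClosed (closure Ω ∩ w ⁻¹' (Set.Ici δ)) :=
      hw.preimage_isClosed_of_isClosed isClosed_closure isClosed_Ici
    exact hc.of_isClosed_subset this (fun x hx => hx.1)
  · intro x hx
    by_contra h
    exact absurd (h0 x hx.1 h) (not_lt.2 hx.2)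

/-- Primitive used to build the regularised fundamental solution. -/
def phiK (ν S : ℝ) (s : ℝ) : ℝ := ∫ t in s..S, t ^ (-ν)

lemma hasDerivAt_phiK {ν S s : ℝ} (hS : 0 < S) (hs : 0 < s) :
    HasDerivAt (phiK ν S) (-(s ^ (-ν))) s := by
  have hc : ∀ t, 0 < t → ContinuousAt (fun t : ℝ => t ^ (-ν)) t := fun t ht =>
    Real.continuousAt_rpow_const _ _ (Or.inl ht.ne')
  apply intervalIntegral.integral_hasDerivAt_left
  · apply ContinuousOn.intervalIntegrable
    intro t ht
    apply (hc t _).continuousWithinAt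
    rcases Set.mem_uIcc.1 ht with h | h <;> linarith [h.1]
  · exact ContinuousAt.stronglyMeasurableAtFilter isOpen_Ioi (fun t ht => hc t ht) s
      (Set.mem_Ioi.2 hs)
  · exact hc s hs

lemma contDiffOn_phiK {ν S : ℝ} (hS : 0 < S) :
    ContDiffOn ℝ (⊤ : ℕ∞) (phiK ν S) (Set.Ioi 0) := by
  rw [contDiffOn_infty_iff_deriv_of_isOpen isOpen_Ioi]
  constructor
  · exact fun s hs => (hasDerivAt_phiK hS hs).differentiableAt.differentiableWithinAt
  · have : ContDiffOn ℝ (⊤ : ℕ∞) (fun s : ℝ => -(s ^ (-ν))) (Set.Ioi 0) :=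
      fun s hs => (Real.contDiffAt_rpow_const_of_ne (ne_of_gt hs)).neg.contDiffWithinAt
    exact this.congr fun s hs => (hasDerivAt_phiK hS hs).deriv

lemma deriv2_phiK {ν S s : ℝ} (hS : 0 < S) (hs : 0 < s) :
    deriv (deriv (phiK ν S)) s = ν * s ^ (-ν - 1) := by
  have : deriv (phiK ν S) =ᶠ[𝓝 s] fun s => -(s ^ (-ν)) := by
    filter_upwards [isOpen_Ioi.mem_nhds hs] with t ht
    exact (hasDerivAt_phiK hS ht).deriv
  rw [this.deriv_eq]
  have h := (Real.hasDerivAt_rpow_const (x := s) (p := -ν) (Or.inl hs.ne')).fun_neg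
  rw [h.deriv]
  ring

lemma phiK_nonneg {ν S s : ℝ} (hs : 0 < s) (hsS : s ≤ S) : 0 ≤ phiK ν S s := by
  apply intervalIntegral.integral_nonneg hsS
  intro t ht
  exact Real.rpow_nonneg (hs.le.trans ht.1) _

lemma phiK_le {ν S β : ℝ} (hβ : 0 < β) (hβν : ν - 1 < β) (hS : 0 < S) :
    ∃ C, 0 < C ∧ ∀ s, 0 < s → s ≤ S → phiK ν S s ≤ C * s ^ (-β) := by
  refine ⟨S ^ (β + 1 - ν) / β, by positivity, ?_⟩
  intro s hs hsS
  set C := S ^ (β + 1 - ν) / β with hC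
  have hCpos : 0 < C := by positivity
  have hd : ∀ t, 0 < t → HasDerivAt (fun t => C * t ^ (-β) - phiK ν S t)
      (C * (-β * t ^ (-β - 1)) - -(t ^ (-ν))) t := by
    intro t ht
    exact ((Real.hasDerivAt_rpow_const (Or.inl ht.ne')).const_mul C).fun_sub (hasDerivAt_phiK hS ht)
  have hanti : AntitoneOn (fun t => C * t ^ (-β) - phiK ν S t) (Set.Icc s S) := by
    apply antitoneOn_of_deriv_nonpos (convex_Icc s S)
    · exact fun t ht => (hd t (hs.trans_le ht.1)).continuousAt.continuousWithinAt
    · intro t ht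
      rw [interior_Icc] at ht
      exact (hd t (hs.trans ht.1)).differentiableAt.differentiableWithinAt
    · intro t ht
      rw [interior_Icc] at ht
      have ht0 : 0 < t := hs.trans ht.1
      rw [(hd t ht0).deriv]
      have h1 : t ^ (-ν) = t ^ (β + 1 - ν) * t ^ (-β - 1) := by
        rw [← Real.rpow_add ht0]; congr 1; ring
      have h2 : t ^ (β + 1 - ν) ≤ S ^ (β + 1 - ν) :=
        Real.rpow_le_rpow ht0.le ht.2.le (by linarith)
      have h3 : C * β = S ^ (β + 1 - ν) := by rw [hC]; field_simp
      have h4 : 0 < t ^ (-β - 1) := Real.rpow_pos_of_pos ht0 _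
      rw [h1]
      nlinarith
  have := hanti (Set.left_mem_Icc.2 hsS) (Set.right_mem_Icc.2 hsS) hsS
  simp only at this
  have h0 : phiK ν S S = 0 := by simp [phiK]
  rw [h0] at this
  have : 0 ≤ C * S ^ (-β) := by positivity
  linarith

section sq
variable {n : ℕ} (x₀ : EuclideanSpace ℝ (Fin n)) (c : ℝ)

lemma contDiff_sqdist : ContDiff ℝ (⊤ : ℕ∞) (fun x => ‖x - x₀‖ ^ 2 + c) :=
  ((contDiff_id.sub contDiff_const).norm_sq ℝ).add contDiff_const

lemma pd_sqdist (i : Fin n) : pd i (fun x => ‖x - x₀‖ ^ 2 + c) = fun x => 2 * (x i - x₀ i) := by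
  funext x
  unfold pd
  have h := (((hasFDerivAt_id x).sub_const x₀).norm_sq).add_const c
  have h2 := h.fderiv
  simp only [id] at h2
  rw [h2]
  simp [EuclideanSpace.inner_single_right]

lemma gsq_sqdist (x) : gsq (fun x => ‖x - x₀‖ ^ 2 + c) x = 4 * ‖x - x₀‖ ^ 2 := by
  unfold gsq
  rw [EuclideanSpace.norm_sq_eq, Finset.mul_sum]
  refine Finset.sum_congr rfl fun i _ => ?_
  rw [pd_sqdist]
  simp only [PiLp.sub_apply, Real.norm_eq_abs, sq_abs]
  ring

lemma lap_sqdist (x) : lap (fun x => ‖x - x₀‖ ^ 2 + c) x = 2 * n := by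
  rw [lap_eq' (contDiff_sqdist x₀ c)]
  have : ∀ i : Fin n, pd i (pd i (fun x => ‖x - x₀‖ ^ 2 + c)) x = 2 := by
    intro i
    rw [pd_sqdist]
    unfold pd
    have h : HasFDerivAt (fun x : EuclideanSpace ℝ (Fin n) => 2 * (x i - x₀ i))
        ((2:ℝ) • (EuclideanSpace.proj i : EuclideanSpace ℝ (Fin n) →L[ℝ] ℝ)) x := by
      have := ((EuclideanSpace.proj (𝕜 := ℝ) i :
        EuclideanSpace ℝ (Fin n) →L[ℝ] ℝ).hasFDerivAt (x := x)).sub_const (x₀ i)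
      exact this.const_mul 2
    rw [h.fderiv]
    simp
  simp [this, mul_comm]
end sq

lemma lap_zero_off {n : ℕ} {K : Set (EuclideanSpace ℝ (Fin n))} (hK : IsClosed K)
    {p : EuclideanSpace ℝ (Fin n) → ℝ} (h0 : ∀ x, x ∉ K → p x = 0) {x} (hx : x ∉ K) :
    lap p x = 0 := by
  have : p =ᶠ[𝓝 x] fun _ => 0 := by
    filter_upwards [hK.isOpen_compl.mem_nhds hx] with y hy using h0 y hy
  rw [lap_congr this, lap_eq' contDiff_const]
  apply Finset.sum_eq_zero
  intro i _
  have : pd i (fun _ : EuclideanSpace ℝ (Fin n) => (0:ℝ)) = fun _ => 0 := by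
    funext y; simp [pd]
  rw [this, this]

/-- Potential estimate. -/
lemma potential {n : ℕ} (hn : 1 ≤ n) {Ω : Set (EuclideanSpace ℝ (Fin n))} (hΩ : IsOpen Ω)
    (hb : Bornology.IsBounded Ω) {ρ : ℝ} (hρ0 : 0 < ρ) (hρ1 : ρ < 1) (hρn : ρ * n < 2) :
    ∃ C, 0 < C ∧ ∀ (p g : EuclideanSpace ℝ (Fin n) → ℝ), ContDiff ℝ (⊤ : ℕ∞) p →
      HasCompactSupport p → (∀ x, 0 ≤ p x) → (∀ x, x ∉ Ω → p x = 0) →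
      (∀ x, x ∉ Ω → lap p x = 0) → ContinuousOn g Ω → (∀ x ∈ Ω, 0 ≤ g x) →
      (∃ B, ∀ x ∈ Ω, g x ≤ B) → (∀ x ∈ Ω, - lap p x ≤ g x) →
      ∀ x, p x ≤ C * (∫ y in Ω, g y ^ (1 / ρ)) ^ ρ := by
  haveI : Nontrivial (EuclideanSpace ℝ (Fin n)) := by
    apply Module.nontrivial_of_finrank_pos (R := ℝ)
    simp; omega
  have hnpos : (0:ℝ) < n := by exact_mod_cast hn
  obtain ⟨R, hR0, hR⟩ := hb.exists_pos_norm_lt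
  set S : ℝ := 4 * R ^ 2 + 1 with hSdef
  have hS : 0 < S := by positivity
  set ν : ℝ := n / 2 with hν
  set q : ℝ := 1 / (1 - ρ) with hq
  have h1ρ : 0 < 1 - ρ := by linarith
  have hqpos : 0 < q := by positivity
  obtain ⟨β, hβ0, hβ1, hβ2⟩ : ∃ β : ℝ, 0 < β ∧ ν - 1 < β ∧ 2 * β * q < n := by
    have h2 : max (ν - 1) 0 < ν * (1 - ρ) := by
      apply max_lt
      · rw [hν]; linarith
      · rw [hν]; positivity
    obtain ⟨β, hβ1, hβ2⟩ := exists_between h2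
    refine ⟨β, (le_max_right _ _).trans_lt hβ1, (le_max_left _ _).trans_lt hβ1, ?_⟩
    rw [hq, mul_one_div, div_lt_iff₀ h1ρ]
    rw [hν] at hβ2
    linarith
  obtain ⟨C1, hC1, hphi⟩ := phiK_le hβ0 hβ1 hS
  -- kernel
  set k : EuclideanSpace ℝ (Fin n) → ℝ :=
    (Metric.ball (0 : EuclideanSpace ℝ (Fin n)) (2 * R)).indicator
      (fun x => ‖x‖ ^ (-(2 * β * q))) with hk
  have hkint : Integrable k := by
    rw [hk, integrable_indicator_iff measurableSet_ball]
    refine integrableOn_ball_of_norm_le_rpow (C := 1) (α := 2 * β * q) ?_ ?_ ?_ ?_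
    · simp; omega
    · simpa using hβ2
    · refine Filter.Eventually.of_forall fun x => ?_
      rw [one_mul, Real.norm_of_nonneg (Real.rpow_nonneg (norm_nonneg _) _)]
    · exact (measurable_norm.pow_const _).aestronglyMeasurable
  have hknn : ∀ x, 0 ≤ k x := fun x =>
    Set.indicator_nonneg (fun x _ => Real.rpow_nonneg (norm_nonneg _) _) x
  set D : ℝ := ∫ x, k x with hD
  have hDnn : 0 ≤ D := integral_nonneg hknn
  set V : ℝ := volume.real (Metric.ball (0 : EuclideanSpace ℝ (Fin n)) 1) with hV
  have hVpos : 0 < V := by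
    rw [hV, Measure.real]
    exact ENNReal.toReal_pos (Metric.measure_ball_pos _ _ one_pos).ne' measure_ball_lt_top.ne
  set c : ℝ := n * 2 ^ (-ν - 1) * V with hc
  have hcpos : 0 < c := by positivity
  set A : ℝ := (C1 ^ q * D) ^ (1 - ρ) with hA
  have hAnn : 0 ≤ A := by positivity
  refine ⟨A / c + 1, by positivity, ?_⟩
  intro p g hp hpc hpnn hp0 hlp0 hgc hgnn hgB hlg x₀
  obtain ⟨B, hB⟩ := hgB
  set I : ℝ := (∫ y in Ω, g y ^ (1 / ρ)) ^ ρ with hI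
  have hInn : 0 ≤ I := Real.rpow_nonneg
    (setIntegral_nonneg hΩ.measurableSet fun x hx => Real.rpow_nonneg (hgnn x hx) _) _
  suffices h : c * p x₀ ≤ A * I by
    have h2 : p x₀ ≤ A / c * I := by
      rw [div_mul_eq_mul_div, le_div_iff₀ hcpos]; linarith
    nlinarith
  by_cases hx0 : p x₀ = 0
  · rw [hx0]; simp; positivity
  have hpx0 : 0 < p x₀ := lt_of_le_of_ne (hpnn x₀) (Ne.symm hx0)
  have hx0Ω : x₀ ∈ Ω := by
    by_contra h
    exact hx0 (hp0 x₀ h)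
  obtain ⟨δ, hδ, hball⟩ : ∃ δ > 0, ∀ x ∈ Metric.ball x₀ δ, p x₀ / 2 ≤ p x := by
    have : ∀ᶠ x in 𝓝 x₀, p x₀ / 2 < p x :=
      hp.continuous.continuousAt.eventually (lt_mem_nhds (by linarith))
    obtain ⟨δ, hδ, h⟩ := Metric.eventually_nhds_iff_ball.1 this
    exact ⟨δ, hδ, fun x hx => (h x hx).le⟩
  obtain ⟨ε, hε, hε1, hεδ⟩ : ∃ ε > 0, ε ≤ 1 ∧ ε ≤ δ :=
    ⟨min 1 δ, by positivity, min_le_left _ _, min_le_right _ _⟩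
  set w : EuclideanSpace ℝ (Fin n) → ℝ := fun x => ‖x - x₀‖ ^ 2 + ε ^ 2 with hw
  have hwpos : ∀ x, 0 < w x := fun x => by positivity
  have hwc : ContDiff ℝ (⊤ : ℕ∞) w := contDiff_sqdist x₀ (ε ^ 2)
  set Φ : EuclideanSpace ℝ (Fin n) → ℝ := fun x => phiK ν S (w x) with hΦ
  have hphiAt : ∀ x, ContDiffAt ℝ (⊤ : ℕ∞) (phiK ν S) (w x) := fun x =>
    (contDiffOn_phiK hS).contDiffAt (isOpen_Ioi.mem_nhds (hwpos x))
  have hΦc : ContDiff ℝ (⊤ : ℕ∞) Φ := by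
    rw [contDiff_iff_contDiffAt]
    exact fun x => (hphiAt x).comp x hwc.contDiffAt
  have hlapΦ : ∀ x, lap Φ x = -(2 * n * ε ^ 2 * w x ^ (-ν - 1)) := by
    intro x
    rw [hΦ, lap_comp ((hphiAt x).of_le two_le_top) (hwc.contDiffAt.of_le two_le_top),
      deriv2_phiK hS (hwpos x), (hasDerivAt_phiK hS (hwpos x)).deriv, gsq_sqdist, lap_sqdist]
    have h1 : w x ^ (-ν) = w x ^ (-ν - 1) * w x := by
      rw [← Real.rpow_add_one (hwpos x).ne']; congr 1; ring
    have h2 : ‖x - x₀‖ ^ 2 = w x - ε ^ 2 := by rw [hw]; ring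
    rw [h1, h2, hν]
    ring
  have hwS : ∀ x ∈ Ω, w x ≤ S := by
    intro x hx
    have h1 : ‖x - x₀‖ ≤ 2 * R := by
      have := norm_sub_le x x₀
      linarith [hR x hx, hR x₀ hx0Ω]
    have h2 : ‖x - x₀‖ ^ 2 ≤ (2 * R) ^ 2 := by gcongr
    have h3 : ε ^ 2 ≤ 1 := by nlinarith
    simp only [hw, hSdef]; nlinarith
  have hΦnn : ∀ x ∈ Ω, 0 ≤ Φ x := fun x hx => phiK_nonneg (hwpos x) (hwS x hx)
  haveI : IsFiniteMeasure (volume.restrict Ω) := ⟨by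
    rw [Measure.restrict_apply_univ]; exact hb.measure_lt_top⟩
  -- upper bound
  have hup : ∫ x, p x * -(lap Φ x) ≤ A * I := by
    have e1 : ∫ x, p x * -(lap Φ x) = ∫ x in Ω, -(lap p x) * Φ x := by
      rw [setIntegral_eq_integral_of_forall_compl_eq_zero]
      · have := ibp_lap hp hΦc hpc
        simp only [mul_neg, neg_mul, integral_neg, this]
      · intro x hx
        rw [hlp0 x hx]; simp
    have gae : 0 ≤ᵐ[volume.restrict Ω] g :=
      (ae_restrict_iff' hΩ.measurableSet).2 (Eventually.of_forall hgnn)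
    have Φae : 0 ≤ᵐ[volume.restrict Ω] Φ :=
      (ae_restrict_iff' hΩ.measurableSet).2 (Eventually.of_forall hΦnn)
    obtain ⟨BΦ, hBΦ⟩ := hb.isCompact_closure.exists_bound_of_continuousOn
      hΦc.continuous.continuousOn
    have gm : ∀ r, MemLp g r (volume.restrict Ω) := fun r =>
      MemLp.of_bound (hgc.aestronglyMeasurable hΩ.measurableSet) B
        ((ae_restrict_iff' hΩ.measurableSet).2 (Eventually.of_forall fun x hx => by
          rw [Real.norm_of_nonneg (hgnn x hx)]; exact hB x hx))
    have Φm : ∀ r, MemLp Φ r (volume.restrict Ω) := fun r =>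
      MemLp.of_bound hΦc.continuous.aestronglyMeasurable BΦ
        ((ae_restrict_iff' hΩ.measurableSet).2 (Eventually.of_forall fun x hx =>
          hBΦ x (subset_closure hx)))
    have e2 : ∫ x in Ω, -(lap p x) * Φ x ≤ ∫ x in Ω, g x * Φ x := by
      apply setIntegral_mono_on
      · have hlc := (contDiff_lap hp).continuous
        exact (((hlc.neg.mul hΦc.continuous).continuousOn).integrableOn_compact
          hb.isCompact_closure).mono_set subset_closure
      · exact MemLp.integrable_mul (gm 2) (Φm 2)
      · exact hΩ.measurableSet
      · exact fun x hx => mul_le_mul_of_nonneg_right (hlg x hx) (hΦnn x hx)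
    have hconj : (1 / ρ).HolderConjugate q := by
      rw [Real.holderConjugate_iff]
      refine ⟨by rw [lt_div_iff₀ hρ0]; linarith, ?_⟩
      rw [hq]; simp
    have e3 := integral_mul_le_Lp_mul_Lq_of_nonneg hconj gae Φae (gm _) (Φm _)
    have e4 : ∫ x in Ω, Φ x ^ q ≤ C1 ^ q * D := by
      have hki : Integrable (fun x => C1 ^ q * k (x - x₀)) := (hkint.comp_sub_right x₀).const_mul _
      calc ∫ x in Ω, Φ x ^ q ≤ ∫ x in Ω, C1 ^ q * k (x - x₀) := by
            apply integral_mono_of_nonneg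
            · exact (ae_restrict_iff' hΩ.measurableSet).2 (Eventually.of_forall fun x hx =>
                Real.rpow_nonneg (hΦnn x hx) _)
            · exact hki.integrableOn
            · rw [Filter.EventuallyLE, ae_restrict_iff' hΩ.measurableSet]
              have hne : ∀ᵐ x : EuclideanSpace ℝ (Fin n), x ≠ x₀ := by
                rw [ae_iff]; simp
              filter_upwards [hne] with x hxne hx
              have hd : 0 < ‖x - x₀‖ := norm_pos_iff.2 (sub_ne_zero.2 hxne)
              have hmem : x - x₀ ∈ Metric.ball (0 : EuclideanSpace ℝ (Fin n)) (2 * R) := by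
                rw [mem_ball_zero_iff]
                have := norm_sub_le x x₀
                linarith [hR x hx, hR x₀ hx0Ω]
              rw [hk, Set.indicator_of_mem hmem]
              have s1 : Φ x ≤ C1 * w x ^ (-β) := hphi _ (hwpos x) (hwS x hx)
              have s2 : w x ^ (-β) ≤ (‖x - x₀‖ ^ 2) ^ (-β) := by
                apply Real.rpow_le_rpow_of_nonpos (by positivity)
                · simp only [hw]; nlinarith
                · linarith
              have s3 : (‖x - x₀‖ ^ 2) ^ (-β) = ‖x - x₀‖ ^ (-(2 * β)) := by
                rw [← Real.rpow_natCast, ← Real.rpow_mul hd.le]; congr 1; push_cast; ring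
              have s4 : Φ x ≤ C1 * ‖x - x₀‖ ^ (-(2 * β)) := by
                rw [← s3]; exact s1.trans (by gcongr)
              calc Φ x ^ q ≤ (C1 * ‖x - x₀‖ ^ (-(2 * β))) ^ q :=
                    Real.rpow_le_rpow (hΦnn x hx) s4 hqpos.le
                _ = C1 ^ q * ‖x - x₀‖ ^ (-(2 * β * q)) := by
                    rw [Real.mul_rpow hC1.le (by positivity), ← Real.rpow_mul hd.le]
                    congr 2; ring
        _ ≤ ∫ x, C1 ^ q * k (x - x₀) := by
            apply setIntegral_le_integral hki
            exact Eventually.of_forall fun x => mul_nonneg (by positivity) (hknn _)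
        _ = C1 ^ q * D := by
            rw [integral_const_mul, integral_sub_right_eq_self]
    have e5 : (∫ x in Ω, Φ x ^ q) ^ (1 / q) ≤ A := by
      have : 1 / q = 1 - ρ := by rw [hq]; simp
      rw [this, hA]
      apply Real.rpow_le_rpow _ e4 h1ρ.le
      exact setIntegral_nonneg hΩ.measurableSet fun x hx => Real.rpow_nonneg (hΦnn x hx) _
    have e6 : (∫ x in Ω, g x ^ (1 / ρ)) ^ (1 / (1 / ρ)) = I := by rw [hI]; simp
    rw [e6] at e3
    calc _ ≤ _ := e1.le
      _ ≤ _ := e2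
      _ ≤ _ := e3
      _ ≤ I * A := by gcongr
      _ = A * I := mul_comm _ _
  have hlow : c * p x₀ ≤ ∫ x, p x * -(lap Φ x) := by
    have hInt0 : Integrable (fun x => p x * -(lap Φ x)) :=
      (hp.continuous.mul (contDiff_lap hΦc).continuous.neg).integrable_of_hasCompactSupport
        hpc.mul_right
    have hnn : ∀ x, 0 ≤ p x * -(lap Φ x) := by
      intro x
      rw [hlapΦ, neg_neg]
      have := hpnn x
      have := (Real.rpow_pos_of_pos (hwpos x) (-ν - 1))
      positivity
    have hvol : volume.real (Metric.ball x₀ ε) = ε ^ n * V := by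
      rw [hV, Measure.real, Measure.real, Measure.addHaar_ball _ _ hε.le, ENNReal.toReal_mul,
        ENNReal.toReal_ofReal (by positivity)]
      simp
    set m : ℝ := p x₀ / 2 * (2 * n * ε ^ 2 * (2 * ε ^ 2) ^ (-ν - 1)) with hm
    have l1 : m * volume.real (Metric.ball x₀ ε) ≤ ∫ x in Metric.ball x₀ ε, p x * -(lap Φ x) := by
      have : ∫ x in Metric.ball x₀ ε, m = m * volume.real (Metric.ball x₀ ε) := by
        rw [setIntegral_const, smul_eq_mul, mul_comm]
      rw [← this]
      apply setIntegral_mono_on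
      · exact integrableOn_const measure_ball_lt_top.ne
      · exact hInt0.integrableOn
      · exact measurableSet_ball
      · intro x hx
        have h1 := hball x (Metric.ball_subset_ball hεδ hx)
        have h2 : w x ≤ 2 * ε ^ 2 := by
          rw [mem_ball_iff_norm] at hx
          have : ‖x - x₀‖ ^ 2 ≤ ε ^ 2 := by gcongr
          simp only [hw]; linarith
        have h3 : (2 * ε ^ 2) ^ (-ν - 1) ≤ w x ^ (-ν - 1) := by
          apply Real.rpow_le_rpow_of_nonpos (hwpos x) h2
          have : 0 < ν := by positivity
          linarith
        rw [hlapΦ, neg_neg, hm]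
        gcongr
        exact hpnn x
    have l2 : m * volume.real (Metric.ball x₀ ε) = c * p x₀ := by
      rw [hvol, hm, hc, Real.mul_rpow (by norm_num) (by positivity)]
      have : (ε ^ 2) ^ (-ν - 1) * (ε ^ 2 * ε ^ n) = 1 := by
        rw [← pow_add, ← Real.rpow_natCast ε (2 + n), ← Real.rpow_natCast ε 2,
          ← Real.rpow_mul hε.le, ← Real.rpow_add hε]
        convert Real.rpow_zero ε using 2
        rw [hν]; push_cast; ring
      linear_combination (n * 2 ^ (-ν - 1) * V * p x₀) * this
    rw [← l2]
    refine l1.trans ?_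
    exact setIntegral_le_integral hInt0 (Eventually.of_forall hnn)
  exact hlow.trans hup

/-- Working form of the hypotheses on the nonlinearity. -/
structure NL (a : ℝ) (f : ℝ → ℝ) : Prop where
  ha : 0 < a
  cont : ContinuousOn f (Set.Ico 0 a)
  smooth : ∀ t ∈ Set.Ioo 0 a, ContDiffAt ℝ (⊤ : ℕ∞) f t
  mono : StrictMonoOn f (Set.Ico 0 a)
  f0 : 0 < f 0
  ypos : ∀ t ∈ Set.Ioo 0 a, 0 < deriv f t
  ymono : MonotoneOn (deriv f) (Set.Ioo 0 a)
  y2 : ∀ t ∈ Set.Ioo 0 a, 0 ≤ deriv (deriv f) t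
  slope : ∀ s t, 0 ≤ s → s < t → t < a → (f t - f s) ≤ deriv f t * (t - s)
  blow : Tendsto f (𝓝[<] a) atTop

lemma domf_coe (a : ℝ) : domf (a : EReal) = Set.Ico 0 a := by
  ext t; simp [domf]

lemma afFilter_coe (a : ℝ) : afFilter (a : EReal) = 𝓝[<] a := by
  simp [afFilter]

lemma HypH.toNL {a : ℝ} {f : ℝ → ℝ} (ha : 0 < a) (hf : HypH (a : EReal) f) : NL a f := by
  have hsm := hf.smooth
  have hmo := hf.mono
  have hcv := hf.convex
  have hbl := hf.blowup
  rw [domf_coe] at hsm hmo hcv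
  rw [afFilter_coe] at hbl
  have hsmA : ∀ t ∈ Set.Ioo 0 a, ContDiffAt ℝ (⊤ : ℕ∞) f t := fun t ht =>
    hsm.contDiffAt (Ico_mem_nhds ht.1 ht.2)
  have hdA : ∀ t ∈ Set.Ioo 0 a, DifferentiableAt ℝ f t := fun t ht =>
    (hsmA t ht).differentiableAt top_ne_zero'
  have hslope : ∀ s t, 0 ≤ s → s < t → t < a → (f t - f s) ≤ deriv f t * (t - s) := by
    intro s t hs hst hta
    have := hcv.slope_le_deriv ⟨hs, hst.trans hta⟩ ⟨hs.trans hst.le, hta⟩ hst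
      (hdA t ⟨hs.trans_lt hst, hta⟩)
    rw [slope_def_field, div_le_iff₀ (by linarith)] at this
    exact this
  have hymono : MonotoneOn (deriv f) (Set.Ioo 0 a) :=
    (hcv.subset Set.Ioo_subset_Ico_self (convex_Ioo 0 a)).monotoneOn_deriv hdA
  refine ⟨ha, hsm.continuousOn, hsmA, hmo, hf.f0_pos, ?_, hymono, ?_, hslope, hbl⟩
  · intro t ht
    have h1 := hslope 0 t le_rfl ht.1 ht.2
    have h2 := hmo ⟨le_rfl, ha⟩ ⟨ht.1.le, ht.2⟩ ht.1
    have h3 := ht.1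
    by_contra h
    push Not at h
    nlinarith
  · intro t ht
    rw [← derivWithin_of_isOpen isOpen_Ioo ht]
    exact hymono.derivWithin_nonneg

/-- `F̃(t) = ∫₀ᵗ (f - f(0))`. -/
def Ft (f : ℝ → ℝ) (t : ℝ) : ℝ := ∫ s in (0:ℝ)..t, (f s - f 0)

def Gt (f : ℝ → ℝ) (t : ℝ) : ℝ := Real.sqrt (2 * Ft f t)

lemma NL.fmono {a : ℝ} {f : ℝ → ℝ} (hf : NL a f) {s t : ℝ} (hs : 0 ≤ s) (hst : s ≤ t)
    (ht : t < a) : f s ≤ f t :=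
  hf.mono.monotoneOn ⟨hs, hst.trans_lt ht⟩ ⟨hs.trans hst, ht⟩ hst

lemma NL.contAt {a : ℝ} {f : ℝ → ℝ} (hf : NL a f) {t : ℝ} (h0 : 0 < t)
    (ht : t < a) : ContinuousAt f t := (hf.smooth t ⟨h0, ht⟩).continuousAt

lemma NL.hd {a : ℝ} {f : ℝ → ℝ} (hf : NL a f) {t : ℝ} (h0 : 0 < t)
    (ht : t < a) : HasDerivAt f (deriv f t) t :=
  ((hf.smooth t ⟨h0, ht⟩).differentiableAt top_ne_zero').hasDerivAt

lemma NL.smooth_y {a : ℝ} {f : ℝ → ℝ} (hf : NL a f) {t : ℝ} (h0 : 0 < t)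
    (ht : t < a) : ContDiffAt ℝ (⊤ : ℕ∞) (deriv f) t := by
  have h : ContDiffOn ℝ (⊤ : ℕ∞) f (Set.Ioo 0 a) := fun s hs => (hf.smooth s hs).contDiffWithinAt
  exact ((contDiffOn_infty_iff_deriv_of_isOpen isOpen_Ioo).1 h).2.contDiffAt
    (isOpen_Ioo.mem_nhds ⟨h0, ht⟩)

lemma NL.hdy {a : ℝ} {f : ℝ → ℝ} (hf : NL a f) {t : ℝ} (h0 : 0 < t)
    (ht : t < a) : HasDerivAt (deriv f) (deriv (deriv f) t) t :=
  ((hf.smooth_y h0 ht).differentiableAt top_ne_zero').hasDerivAt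

lemma NL.ftpos {a : ℝ} {f : ℝ → ℝ} (hf : NL a f) {t : ℝ} (h0 : 0 < t)
    (ht : t < a) : 0 < f t - f 0 :=
  sub_pos.2 (hf.mono ⟨le_rfl, hf.ha⟩ ⟨h0.le, ht⟩ h0)

lemma NL.hasDerivAt_Ft {a : ℝ} {f : ℝ → ℝ} (hf : NL a f) {t : ℝ} (h0 : 0 < t)
    (ht : t < a) : HasDerivAt (Ft f) (f t - f 0) t := by
  apply intervalIntegral.integral_hasDerivAt_right
  · apply ContinuousOn.intervalIntegrable
    rw [Set.uIcc_of_le h0.le]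
    exact (hf.cont.mono fun s hs => ⟨hs.1, hs.2.trans_lt ht⟩).sub continuousOn_const
  · exact ContinuousAt.stronglyMeasurableAtFilter isOpen_Ioo
      (fun s hs => (hf.contAt hs.1 hs.2).sub continuousAt_const) t (⟨h0, ht⟩ : t ∈ Set.Ioo 0 a)
  · exact (hf.contAt h0 ht).sub continuousAt_const

lemma NL.continuousOn_Ft {a : ℝ} {f : ℝ → ℝ} (hf : NL a f) :
    ContinuousOn (Ft f) (Set.Ico 0 a) := by
  intro t ht
  set b := (t + a) / 2 with hb
  have htb : t < b := by rw [hb]; linarith [ht.2]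
  have hba : b < a := by rw [hb]; linarith [ht.2]
  have hb0 : 0 ≤ b := ht.1.trans htb.le
  have hc : ContinuousOn (fun s => f s - f 0) (Set.Icc 0 b) :=
    (hf.cont.mono fun s hs => ⟨hs.1, hs.2.trans_lt hba⟩).sub continuousOn_const
  have h : ContinuousOn (Ft f) (Set.Icc 0 b) := by
    have h1 := intervalIntegral.continuousOn_primitive_interval (μ := volume)
      (f := fun s => f s - f 0) (a := 0) (b := b) (by
        rw [Set.uIcc_of_le hb0]; exact hc.integrableOn_Icc)
    rwa [Set.uIcc_of_le hb0] at h1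
  have h1 := h t ⟨ht.1, htb.le⟩
  refine h1.mono_of_mem_nhdsWithin ?_
  rw [mem_nhdsWithin]
  exact ⟨Set.Iio b, isOpen_Iio, htb, fun s hs => ⟨hs.2.1, (le_of_lt hs.1)⟩⟩

lemma Ft_zero (f : ℝ → ℝ) : Ft f 0 = 0 := by simp [Ft]
lemma Gt_zero (f : ℝ → ℝ) : Gt f 0 = 0 := by simp [Gt, Ft_zero]
lemma Gt_nonneg (f : ℝ → ℝ) (t : ℝ) : 0 ≤ Gt f t := Real.sqrt_nonneg _

lemma NL.continuousOn_Gt {a : ℝ} {f : ℝ → ℝ} (hf : NL a f) :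
    ContinuousOn (Gt f) (Set.Ico 0 a) :=
  (continuousOn_const.mul hf.continuousOn_Ft).sqrt

lemma NL.Ft_pos {a : ℝ} {f : ℝ → ℝ} (hf : NL a f) {t : ℝ} (h0 : 0 < t)
    (ht : t < a) : 0 < Ft f t := by
  have : StrictMonoOn (Ft f) (Set.Icc 0 t) := by
    apply strictMonoOn_of_deriv_pos (convex_Icc 0 t)
    · exact hf.continuousOn_Ft.mono fun s hs => ⟨hs.1, hs.2.trans_lt ht⟩
    · intro s hs
      rw [interior_Icc] at hs
      rw [(hf.hasDerivAt_Ft hs.1 (hs.2.trans ht)).deriv]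
      exact hf.ftpos hs.1 (hs.2.trans ht)
  have := this (Set.left_mem_Icc.2 h0.le) (Set.right_mem_Icc.2 h0.le) h0
  rwa [Ft_zero] at this

/-- `f̃² ≤ 2 F̃ f'`. -/
lemma NL.ft_sq_le {a : ℝ} {f : ℝ → ℝ} (hf : NL a f) {T : ℝ} (h0 : 0 < T)
    (hT : T < a) : (f T - f 0) ^ 2 ≤ 2 * Ft f T * deriv f T := by
  have hd : ∀ t, 0 < t → t < a → HasDerivAt (fun t => 2 * Ft f t * deriv f T - (f t - f 0) ^ 2)
      (2 * (f t - f 0) * deriv f T - 2 * (f t - f 0) * deriv f t) t := by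
    intro t ht0 hta
    have h1 := ((hf.hasDerivAt_Ft ht0 hta).const_mul 2).mul_const (deriv f T)
    have h2 := ((hf.hd ht0 hta).sub_const (f 0)).fun_pow 2
    refine (h1.fun_sub h2).congr_deriv ?_
    norm_num
    try ring
  have : MonotoneOn (fun t => 2 * Ft f t * deriv f T - (f t - f 0) ^ 2) (Set.Icc 0 T) := by
    apply monotoneOn_of_deriv_nonneg (convex_Icc 0 T)
    · have hs : Set.Icc 0 T ⊆ Set.Ico 0 a := fun s hs => ⟨hs.1, hs.2.trans_lt hT⟩
      exact ((continuousOn_const.mul (hf.continuousOn_Ft.mono hs)).mul continuousOn_const).sub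
        (((hf.cont.mono hs).sub continuousOn_const).pow 2)
    · intro s hs
      rw [interior_Icc] at hs
      exact (hd s hs.1 (hs.2.trans hT)).differentiableAt.differentiableWithinAt
    · intro s hs
      rw [interior_Icc] at hs
      rw [(hd s hs.1 (hs.2.trans hT)).deriv]
      have h1 := hf.ftpos hs.1 (hs.2.trans hT)
      have h2 := hf.ymono ⟨hs.1, hs.2.trans hT⟩ ⟨h0, hT⟩ hs.2.le
      nlinarith
  have := this (Set.left_mem_Icc.2 h0.le) (Set.right_mem_Icc.2 h0.le) h0.le
  simp only [Ft_zero] at this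
  linarith

lemma NL.Gt_pos {a : ℝ} {f : ℝ → ℝ} (hf : NL a f) {t : ℝ} (h0 : 0 < t)
    (ht : t < a) : 0 < Gt f t := Real.sqrt_pos.2 (by linarith [hf.Ft_pos h0 ht])

lemma NL.Gt_sq {a : ℝ} {f : ℝ → ℝ} (hf : NL a f) {t : ℝ} (h0 : 0 < t)
    (ht : t < a) : Gt f t ^ 2 = 2 * Ft f t := Real.sq_sqrt (by linarith [hf.Ft_pos h0 ht])

lemma NL.hasDerivAt_Gt {a : ℝ} {f : ℝ → ℝ} (hf : NL a f) {t : ℝ} (h0 : 0 < t)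
    (ht : t < a) : HasDerivAt (Gt f) ((f t - f 0) / Gt f t) t := by
  have hp := hf.Ft_pos h0 ht
  have := ((hf.hasDerivAt_Ft h0 ht).const_mul 2).sqrt (by positivity)
  refine HasDerivAt.congr_deriv (f := Gt f) this ?_
  rw [mul_div_mul_left _ _ two_ne_zero]; rfl

lemma NL.contDiffAt_Gt {a : ℝ} {f : ℝ → ℝ} (hf : NL a f) {t : ℝ} (h0 : 0 < t)
    (ht : t < a) : ContDiffAt ℝ 2 (Gt f) t := by
  have h : ContDiffOn ℝ (⊤ : ℕ∞) (Ft f) (Set.Ioo 0 a) := by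
    rw [contDiffOn_infty_iff_deriv_of_isOpen isOpen_Ioo]
    constructor
    · exact fun s hs => (hf.hasDerivAt_Ft hs.1 hs.2).differentiableAt.differentiableWithinAt
    · have : ContDiffOn ℝ (⊤ : ℕ∞) (fun s => f s - f 0) (Set.Ioo 0 a) :=
        fun s hs => ((hf.smooth s hs).sub contDiffAt_const).contDiffWithinAt
      exact this.congr fun s hs => (hf.hasDerivAt_Ft hs.1 hs.2).deriv
  have h1 : ContDiffAt ℝ (⊤ : ℕ∞) (Ft f) t := h.contDiffAt (isOpen_Ioo.mem_nhds ⟨h0, ht⟩)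
  have h2 := (contDiffAt_const (c := (2:ℝ))).mul h1
  have hp := hf.Ft_pos h0 ht
  exact (h2.sqrt (by positivity)).of_le two_le_top

lemma NL.deriv2_Gt {a : ℝ} {f : ℝ → ℝ} (hf : NL a f) {t : ℝ} (h0 : 0 < t)
    (ht : t < a) : 0 ≤ deriv (deriv (Gt f)) t := by
  have he : deriv (Gt f) =ᶠ[𝓝 t] fun s => (f s - f 0) / Gt f s := by
    filter_upwards [isOpen_Ioo.mem_nhds (⟨h0, ht⟩ : t ∈ Set.Ioo 0 a)] with s hs
    exact (hf.hasDerivAt_Gt hs.1 hs.2).deriv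
  rw [he.deriv_eq]
  have hg := hf.Gt_pos h0 ht
  have h := ((hf.hd h0 ht).sub_const (f 0)).fun_div (hf.hasDerivAt_Gt h0 ht) hg.ne'
  rw [h.deriv]
  apply div_nonneg _ (sq_nonneg _)
  have h1 := hf.ft_sq_le h0 ht
  rw [← hf.Gt_sq h0 ht] at h1
  rw [sub_nonneg, mul_div_assoc', div_le_iff₀ hg]
  nlinarith

/-- The real variable estimates near the singularity. -/
lemma NL.real_part {a : ℝ} {f : ℝ → ℝ} (hf : NL a f) {γ ρ : ℝ} (hγ0 : 0 < γ) (hγ2 : γ < 2)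
    (hev : ∀ᶠ t in 𝓝[<] a, f t * deriv (deriv f) t ≤ γ * deriv f t ^ 2)
    (hρ0 : γ / 4 < ρ) (hρ1 : ρ < 1 / 2) (hρ2 : ρ < γ / 3) :
    ∃ (t0 t1 c C κ : ℝ) (H h k : ℝ → ℝ), 0 < t0 ∧ t0 < t1 ∧ t1 < a ∧ 0 < c ∧ 0 < C ∧ 0 < κ ∧
      (∀ t, t0 ≤ t → t < a → f 0 + 2 ≤ f t) ∧ (∀ t, t0 ≤ t → t < a → 2 * f t ≤ deriv f t * t) ∧
      (∀ t, 0 < t → t < a → ContDiffAt ℝ (⊤ : ℕ∞) H t) ∧ (∀ t, 0 < t → t ≤ t0 → H t = 0) ∧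
      (∀ t, 0 ≤ H t) ∧ (∀ t, 0 < t → t ≤ t0 → deriv H t = 0) ∧
      (∀ t, t0 ≤ t → t < a → deriv H t ≤ C * deriv (deriv f) t * Gt f t) ∧
      (∀ t, t1 ≤ t → t < a → c ≤ h t) ∧ (∀ t, t1 ≤ t → t < a → c ≤ k t) ∧
      (∀ t, t1 ≤ t → t < a → h t * k t ≤ C * f t ^ (1 - κ)) ∧
      (∀ t s, t1 ≤ t → t ≤ s → s < a → f t ^ (1 / ρ) ≤ C * (H t * Gt f t) * h s ^ (1 / ρ)) ∧
      (∀ t s, t1 ≤ t → t ≤ s → s < a →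
        deriv f t ^ (1 / ρ) ≤ C * (H t * Gt f t) * k s ^ (1 / ρ)) := by
  set y : ℝ → ℝ := deriv f with hy
  have ha := hf.ha
  have hsa : 3 * a / 4 < a := by linarith
  -- choice of t0
  obtain ⟨t0, ht00, ht0a, h34, hP⟩ : ∃ t0, 0 < t0 ∧ t0 < a ∧ 3 * a / 4 < t0 ∧
      ∀ t, t0 ≤ t → t < a → f t * deriv y t ≤ γ * y t ^ 2 ∧ 2 * f 0 + 2 ≤ f t ∧
        3 * f (3 * a / 4) ≤ f t := by
    have h1 := hev.and ((hf.blow.eventually_ge_atTop (2 * f 0 + 2)).and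
      (hf.blow.eventually_ge_atTop (3 * f (3 * a / 4))))
    obtain ⟨l, hl, hsub⟩ := (mem_nhdsLT_iff_exists_Ioo_subset).1 h1
    have hl' : l < a := hl
    have hm : max l (3 * a / 4) < a := max_lt hl' hsa
    refine ⟨(max l (3 * a / 4) + a) / 2, ?_, by linarith, ?_, ?_⟩
    · have := le_max_right l (3 * a / 4); linarith
    · have := le_max_right l (3 * a / 4); linarith
    · intro t ht hta
      have := le_max_left l (3 * a / 4)
      exact hsub ⟨by linarith, hta⟩
  have hypos : ∀ t, t0 ≤ t → t < a → 0 < y t := fun t ht hta => hf.ypos t ⟨ht00.trans_le ht, hta⟩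
  have hfpos : ∀ t, t0 ≤ t → t < a → 0 < f t := fun t ht hta => by
    have := (hP t ht hta).2.1; linarith [hf.f0]
  have hyslope : ∀ t, t0 ≤ t → t < a → 2 * f t ≤ 3 * a / 4 * y t := by
    intro t ht hta
    have h1 := hf.slope (3 * a / 4) t (by positivity) (by linarith) hta
    have h2 := (hP t ht hta).2.2
    have h3 := hypos t ht hta
    have h4 : y t * (t - 3 * a / 4) ≤ y t * (a / 4) :=
      mul_le_mul_of_nonneg_left (by linarith) h3.le
    change _ ≤ y t * _ at h1
    linarith
  -- antitone quotient
  have hqanti : AntitoneOn (fun t => y t * f t ^ (-γ)) (Set.Ico t0 a) := by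
    have hd : ∀ t, t0 ≤ t → t < a → HasDerivAt (fun t => y t * f t ^ (-γ))
        (deriv y t * f t ^ (-γ) + y t * (y t * (-γ) * f t ^ (-γ - 1))) t := by
      intro t ht hta
      have h1 := hf.hdy (ht00.trans_le ht) hta
      have h2 := (hf.hd (ht00.trans_le ht) hta).rpow_const (p := -γ) (Or.inl (hfpos t ht hta).ne')
      exact h1.mul h2
    apply antitoneOn_of_deriv_nonpos (convex_Ico t0 a)
    · exact fun t ht => (hd t ht.1 ht.2).continuousAt.continuousWithinAt
    · intro t ht
      rw [interior_Ico] at ht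
      exact (hd t ht.1.le ht.2).differentiableAt.differentiableWithinAt
    · intro t ht
      rw [interior_Ico] at ht
      rw [(hd t ht.1.le ht.2).deriv]
      have hfp := hfpos t ht.1.le ht.2
      have e : f t ^ (-γ) = f t ^ (-γ - 1) * f t := by
        rw [← Real.rpow_add_one hfp.ne']; congr 1; ring
      have h1 := (hP t ht.1.le ht.2).1
      have h2 := Real.rpow_pos_of_pos hfp (-γ - 1)
      rw [e]
      nlinarith
  set C2 : ℝ := y t0 * f t0 ^ (-γ) with hC2
  have hC2pos : 0 < C2 := mul_pos (hypos t0 le_rfl ht0a)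
    (Real.rpow_pos_of_pos (hfpos t0 le_rfl ht0a) _)
  have hyf : ∀ t, t0 ≤ t → t < a → y t ≤ C2 * f t ^ γ := by
    intro t ht hta
    have h1 : y t * f t ^ (-γ) ≤ C2 := hqanti ⟨le_rfl, ht0a⟩ ⟨ht, hta⟩ ht
    have hfp := hfpos t ht hta
    rw [Real.rpow_neg hfp.le, ← div_eq_mul_inv, div_le_iff₀ (by positivity)] at h1
    exact h1
  set D : ℝ := C2 ^ (1 / γ) with hD
  have hDpos : 0 < D := by positivity
  have hyD : ∀ t, t0 ≤ t → t < a → y t ^ (1 / γ) ≤ D * f t := by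
    intro t ht hta
    have hfp := hfpos t ht hta
    calc y t ^ (1 / γ) ≤ (C2 * f t ^ γ) ^ (1 / γ) :=
          Real.rpow_le_rpow (hypos t ht hta).le (hyf t ht hta) (by positivity)
      _ = D * f t := by
          rw [Real.mul_rpow hC2pos.le (by positivity), ← Real.rpow_mul hfp.le,
            mul_one_div_cancel hγ0.ne', Real.rpow_one]
  -- lower bound for G
  obtain ⟨e, he, hG⟩ : ∃ e, 0 < e ∧ ∀ t, t0 ≤ t → t < a → e * f t ≤ Gt f t * √(y t) := by
    have hF0 := hf.Ft_pos ht00 ht0a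
    have hf0 := hfpos t0 le_rfl ht0a
    have hy0 := hypos t0 le_rfl ht0a
    obtain ⟨ε, hε, hε4, hεF⟩ : ∃ ε, 0 < ε ∧ ε ≤ 1 / 4 ∧ ε * (f t0 ^ 2 / y t0) ≤ Ft f t0 := by
      refine ⟨min (1 / 4) (Ft f t0 / (f t0 ^ 2 / y t0)), by positivity, min_le_left _ _, ?_⟩
      rw [← le_div_iff₀ (by positivity)]
      exact min_le_right _ _
    have hd : ∀ t, t0 ≤ t → t < a → HasDerivAt (fun t => Ft f t - ε * (f t ^ 2 / y t))
        ((f t - f 0) - ε * ((2 * f t * y t * y t - f t ^ 2 * deriv y t) / y t ^ 2)) t := by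
      intro t ht hta
      have ht' := ht00.trans_le ht
      have h1 := hf.hasDerivAt_Ft ht' hta
      have h2 := ((hf.hd ht' hta).fun_pow 2).fun_div (hf.hdy ht' hta) (hypos t ht hta).ne'
      refine (h1.fun_sub (h2.const_mul ε)).congr_deriv ?_
      norm_num
      try simp [hy]
    have hm : MonotoneOn (fun t => Ft f t - ε * (f t ^ 2 / y t)) (Set.Ico t0 a) := by
      apply monotoneOn_of_deriv_nonneg (convex_Ico t0 a)
      · exact fun t ht => (hd t ht.1 ht.2).continuousAt.continuousWithinAt
      · intro t ht
        rw [interior_Ico] at ht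
        exact (hd t ht.1.le ht.2).differentiableAt.differentiableWithinAt
      · intro t ht
        rw [interior_Ico] at ht
        rw [(hd t ht.1.le ht.2).deriv]
        have hfp := hfpos t ht.1.le ht.2
        have hyp := hypos t ht.1.le ht.2
        have h2 : 0 ≤ deriv y t := hf.y2 t ⟨ht00.trans ht.1, ht.2⟩
        have h3 : (2 * f t * y t * y t - f t ^ 2 * deriv y t) / y t ^ 2 ≤ 2 * f t := by
          rw [div_le_iff₀ (by positivity)]
          have : 0 ≤ f t ^ 2 * deriv y t := by positivity
          nlinarith
        have h4 := (hP t ht.1.le ht.2).2.1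
        have h5 : ε * ((2 * f t * y t * y t - f t ^ 2 * deriv y t) / y t ^ 2) ≤ 1 / 4 * (2 * f t) :=
          (mul_le_mul_of_nonneg_left h3 hε.le).trans
            (mul_le_mul_of_nonneg_right hε4 (by positivity))
        linarith
    refine ⟨√(2 * ε), by positivity, ?_⟩
    intro t ht hta
    have hfp := hfpos t ht hta
    have hyp := hypos t ht hta
    have h1 := hm ⟨le_rfl, ht0a⟩ ⟨ht, hta⟩ ht
    simp only at h1
    have h2 : ε * (f t ^ 2 / y t) ≤ Ft f t := by linarith
    have h3 : ε * f t ^ 2 ≤ Ft f t * y t := by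
      rw [← mul_div_assoc, div_le_iff₀ hyp] at h2; exact h2
    unfold Gt
    rw [← Real.sqrt_mul (by linarith [hf.Ft_pos (ht00.trans_le ht) hta])]
    apply Real.le_sqrt_of_sq_le
    rw [mul_pow, Real.sq_sqrt (by positivity)]
    linarith
  obtain ⟨η, hηc, hη0, hηd0, hηd1, hηdd, hηnn, hηlow, hηd, hηup⟩ := exists_cutoff 1 one_pos
  set σ : ℝ := 1 / γ + 1 / 2 with hσ
  have hσpos : 0 < σ := by positivity
  set Y0 : ℝ := y t0 ^ σ with hY0
  have hY0pos : 0 < Y0 := Real.rpow_pos_of_pos (hypos t0 le_rfl ht0a) _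
  -- choice of t1
  obtain ⟨t1, ht01, ht1a, hY1⟩ : ∃ t1, t0 < t1 ∧ t1 < a ∧
      ∀ t, t1 ≤ t → t < a → 2 * (Y0 + 2) ≤ y t ^ σ := by
    set M : ℝ := (2 * (Y0 + 2)) ^ (1 / σ) with hM
    have h1 := (hf.blow.eventually_ge_atTop (3 * a / 4 * M / 2))
    obtain ⟨l, hl, hsub⟩ := (mem_nhdsLT_iff_exists_Ioo_subset).1 h1
    have hl' : l < a := hl
    have hm : max l t0 < a := max_lt hl' ht0a
    have m1 := le_max_left l t0
    have m2 := le_max_right l t0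
    refine ⟨(max l t0 + a) / 2, by linarith, by linarith, ?_⟩
    intro t ht hta
    have h2 : 3 * a / 4 * M / 2 ≤ f t := hsub ⟨by linarith, hta⟩
    have h3 := hyslope t (by linarith) hta
    have h4 : M ≤ y t := by
      have : 3 * a / 4 * M ≤ 3 * a / 4 * y t := by linarith
      exact le_of_mul_le_mul_left this (by positivity)
    calc 2 * (Y0 + 2) = M ^ σ := by
          rw [hM, ← Real.rpow_mul (by positivity), one_div_mul_cancel hσpos.ne', Real.rpow_one]
      _ ≤ y t ^ σ := Real.rpow_le_rpow (by positivity) h4 hσpos.le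
  have hyσ : ∀ t, t0 ≤ t → t < a → y t ^ σ = y t ^ (1 / γ) * √(y t) := by
    intro t ht hta
    rw [hσ, Real.rpow_add (hypos t ht hta), Real.sqrt_eq_rpow]
  set H : ℝ → ℝ := fun t => η (y t ^ σ - Y0) with hH
  have hHG : ∀ t, t1 ≤ t → t < a → e / 2 * (f t * y t ^ (1 / γ)) ≤ H t * Gt f t := by
    intro t ht hta
    have ht' : t0 ≤ t := ht01.le.trans ht
    have h1 := hY1 t ht hta
    have h2 := hηlow (y t ^ σ - Y0) (by linarith)
    have h3 : y t ^ σ / 2 ≤ H t := by simp only [hH]; linarith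
    have h4 := hG t ht' hta
    rw [hyσ t ht' hta] at h3
    have hyp := hypos t ht' hta
    have hs : 0 < √(y t) := Real.sqrt_pos.2 hyp
    have hr : 0 < y t ^ (1 / γ) := by positivity
    have h5 : y t ^ (1 / γ) * √(y t) / 2 * Gt f t ≤ H t * Gt f t :=
      mul_le_mul_of_nonneg_right h3 (Gt_nonneg f t)
    have h6 : y t ^ (1 / γ) * (e * f t) ≤ y t ^ (1 / γ) * (Gt f t * √(y t)) :=
      mul_le_mul_of_nonneg_left h4 hr.le
    linarith
  have hlow : ∀ t, 0 < t → t ≤ t0 → y t ^ σ - Y0 ≤ 0 := by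
    intro t ht htt
    have h1 : y t ≤ y t0 := hf.ymono ⟨ht, htt.trans_lt ht0a⟩ ⟨ht00, ht0a⟩ htt
    have h2 : y t ^ σ ≤ Y0 :=
      Real.rpow_le_rpow (hf.ypos t ⟨ht, htt.trans_lt ht0a⟩).le h1 hσpos.le
    linarith
  have hHd : ∀ t, 0 < t → t < a → HasDerivAt H
      (deriv η (y t ^ σ - Y0) * (deriv y t * σ * y t ^ (σ - 1))) t := by
    intro t ht hta
    have h1 := ((hf.hdy ht hta).rpow_const (p := σ)
      (Or.inl (hf.ypos t ⟨ht, hta⟩).ne')).sub_const Y0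
    have h2 : HasDerivAt η (deriv η (y t ^ σ - Y0)) (y t ^ σ - Y0) :=
      (hηc.differentiable top_ne_zero' _).hasDerivAt
    exact h2.comp t h1
  have hηd00 : ∀ s, s ≤ 0 → deriv η s = 0 := by
    intro s hs
    have : η =ᶠ[𝓝 s] fun _ => 0 := by
      filter_upwards [isOpen_Iio.mem_nhds (show s < 1 by linarith)] with r hr
      exact hη0 r (le_of_lt hr)
    rw [this.deriv_eq, deriv_const]
  set h : ℝ → ℝ := fun t => f t ^ (1 - ρ) * y t ^ (-(ρ / γ)) with hh
  set k : ℝ → ℝ := fun t => y t ^ (1 - 2 * ρ / γ) with hk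
  have hργ : ρ / γ < 1 / 3 := by rw [div_lt_iff₀ hγ0]; linarith
  have hρpos : 0 < ρ := by linarith
  have hhpos : ∀ t, t0 ≤ t → t < a → 0 < h t := fun t ht hta =>
    mul_pos (Real.rpow_pos_of_pos (hfpos t ht hta) _) (Real.rpow_pos_of_pos (hypos t ht hta) _)
  have hkpos : ∀ t, t0 ≤ t → t < a → 0 < k t := fun t ht hta =>
    (Real.rpow_pos_of_pos (hypos t ht hta) _)
  have hhmono : ∀ t s, t0 ≤ t → t ≤ s → s < a → h t ≤ h s := by
    have key : ∀ t, t0 ≤ t → t < a → h t = f t ^ (1 - 2 * ρ) * (y t * f t ^ (-γ)) ^ (-(ρ / γ)) := by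
      intro t ht hta
      have hfp := hfpos t ht hta
      have hyp := hypos t ht hta
      rw [Real.mul_rpow hyp.le (by positivity), ← Real.rpow_mul hfp.le]
      have : f t ^ (1 - ρ) = f t ^ (1 - 2 * ρ) * f t ^ (-γ * -(ρ / γ)) := by
        rw [← Real.rpow_add hfp]; congr 1; field_simp; ring
      simp only [hh]
      rw [this]; ring
    intro t s ht hts hsa
    have hta := hts.trans_lt hsa
    have hfp := hfpos t ht hta
    have hyp := hypos t ht hta
    have hfs := hfpos s (ht.trans hts) hsa
    have hys := hypos s (ht.trans hts) hsa
    rw [key t ht hta, key s (ht.trans hts) hsa]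
    have i1 : f t ^ (1 - 2 * ρ) ≤ f s ^ (1 - 2 * ρ) :=
      Real.rpow_le_rpow hfp.le (hf.fmono (ht00.le.trans ht) hts hsa) (by linarith)
    have i2 : (y t * f t ^ (-γ)) ^ (-(ρ / γ)) ≤ (y s * f s ^ (-γ)) ^ (-(ρ / γ)) := by
      apply Real.rpow_le_rpow_of_nonpos (by positivity)
      · exact hqanti ⟨ht, hta⟩ ⟨ht.trans hts, hsa⟩ hts
      · have : 0 < ρ / γ := by positivity
        linarith
    exact mul_le_mul i1 i2 (by positivity) (by positivity)
  have hexp : 0 < 1 - 2 * ρ / γ := by rw [mul_div_assoc]; linarith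
  have hkmono : ∀ t s, t0 ≤ t → t ≤ s → s < a → k t ≤ k s := by
    intro t s ht hts hsa
    have hta := hts.trans_lt hsa
    exact Real.rpow_le_rpow (hypos t ht hta).le
      (hf.ymono ⟨ht00.trans_le ht, hta⟩ ⟨ht00.trans_le (ht.trans hts), hsa⟩ hts) hexp.le
  set Ca : ℝ := σ * D / e with hCa
  set Cb : ℝ := C2 ^ (1 - 3 * ρ / γ) with hCb
  set Cc : ℝ := 2 / e with hCc
  set Cd : ℝ := D * (2 / e) with hCd
  have hCap : 0 < Ca := by positivity
  have hCbp : 0 < Cb := by positivity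
  have hCcp : 0 < Cc := by positivity
  have hCdp : 0 < Cd := by positivity
  have hHGnn : ∀ t, 0 ≤ H t * Gt f t := fun t => mul_nonneg (hηnn _) (Gt_nonneg f t)
  refine ⟨t0, t1, min (h t1) (k t1), Ca + Cb + Cc + Cd, 4 * ρ - γ, H, h, k, ht00, ht01, ht1a,
    lt_min (hhpos t1 ht01.le ht1a) (hkpos t1 ht01.le ht1a), by positivity, by linarith,
    ?_, ?_, ?_, ?_, fun t => hηnn _, ?_, ?_, ?_, ?_, ?_, ?_, ?_⟩
  · intro t ht hta
    linarith [(hP t ht hta).2.1, hf.f0]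
  · intro t ht hta
    have h1 := hyslope t ht hta
    have h2 := hypos t ht hta
    nlinarith
  · intro t ht hta
    apply hηc.contDiffAt.comp t
    exact ((hf.smooth_y ht hta).rpow_const_of_ne (hf.ypos t ⟨ht, hta⟩).ne').sub contDiffAt_const
  · intro t ht htt
    exact hη0 _ (by linarith [hlow t ht htt])
  · intro t ht htt
    rw [(hHd t ht (htt.trans_lt ht0a)).deriv, hηd00 _ (hlow t ht htt), zero_mul]
  · intro t ht hta
    have ht' := ht00.trans_le ht
    have hyp := hypos t ht hta
    have h2 : 0 ≤ deriv y t := hf.y2 t ⟨ht', hta⟩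
    have h3 : y t ^ (σ - 1) ≤ D / e * Gt f t := by
      have hs : 0 < √(y t) := Real.sqrt_pos.2 hyp
      have e1 : y t ^ (σ - 1) * √(y t) = y t ^ (1 / γ) := by
        rw [Real.sqrt_eq_rpow, ← Real.rpow_add hyp]; congr 1; rw [hσ]; ring
      have h4 := hG t ht hta
      have h5 := hyD t ht hta
      have h6 : y t ^ (σ - 1) * √(y t) ≤ (D / e * Gt f t) * √(y t) := by
        rw [e1]
        calc y t ^ (1 / γ) ≤ D * f t := h5
          _ = D / e * (e * f t) := by field_simp
          _ ≤ D / e * (Gt f t * √(y t)) := by gcongr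
          _ = _ := by ring
      exact le_of_mul_le_mul_right h6 hs
    rw [(hHd t ht' hta).deriv]
    have h4 : 0 ≤ deriv y t * σ * y t ^ (σ - 1) := by positivity
    have hGn := Gt_nonneg f t
    calc _ ≤ 1 * (deriv y t * σ * y t ^ (σ - 1)) := mul_le_mul_of_nonneg_right (hηd1 _) h4
      _ ≤ deriv y t * σ * (D / e * Gt f t) := by rw [one_mul]; gcongr
      _ = Ca * deriv y t * Gt f t := by rw [hCa]; ring
      _ ≤ (Ca + Cb + Cc + Cd) * deriv y t * Gt f t := by gcongr; linarith
  · exact fun t ht hta => (min_le_left _ _).trans (hhmono t1 t ht01.le ht hta)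
  · exact fun t ht hta => (min_le_right _ _).trans (hkmono t1 t ht01.le ht hta)
  · intro t ht hta
    have ht' := ht01.le.trans ht
    have hyp := hypos t ht' hta
    have hfp := hfpos t ht' hta
    have e1 : h t * k t = f t ^ (1 - ρ) * y t ^ (1 - 3 * ρ / γ) := by
      simp only [hh, hk]
      rw [mul_assoc, ← Real.rpow_add hyp]; congr 2; field_simp; ring
    have h0 : 0 ≤ 1 - 3 * ρ / γ := by rw [mul_div_assoc]; linarith
    have e2 : y t ^ (1 - 3 * ρ / γ) ≤ Cb * (f t ^ γ) ^ (1 - 3 * ρ / γ) := by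
      rw [hCb, ← Real.mul_rpow hC2pos.le (by positivity)]
      exact Real.rpow_le_rpow hyp.le (hyf t ht' hta) h0
    rw [e1]
    calc _ ≤ f t ^ (1 - ρ) * (Cb * (f t ^ γ) ^ (1 - 3 * ρ / γ)) := by gcongr
      _ = Cb * f t ^ (1 - (4 * ρ - γ)) := by
        rw [← Real.rpow_mul hfp.le, mul_left_comm, ← Real.rpow_add hfp]; congr 2; field_simp; ring
      _ ≤ _ := by gcongr; linarith
  · intro t s ht hts hsa
    have hta := hts.trans_lt hsa
    have ht' := ht01.le.trans ht
    have hyp := hypos t ht' hta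
    have hfp := hfpos t ht' hta
    have e1 : f t ^ (1 / ρ) = (f t * y t ^ (1 / γ)) * h t ^ (1 / ρ) := by
      simp only [hh]
      rw [Real.mul_rpow (by positivity) (by positivity), ← Real.rpow_mul hfp.le,
        ← Real.rpow_mul hyp.le]
      have a1 : f t ^ (1 / ρ) = f t * f t ^ ((1 - ρ) * (1 / ρ)) := by
        rw [mul_comm, ← Real.rpow_add_one hfp.ne']; congr 1; field_simp; ring
      have a2 : y t ^ (1 / γ) * y t ^ (-(ρ / γ) * (1 / ρ)) = 1 := by
        rw [← Real.rpow_add hyp]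
        convert Real.rpow_zero (y t) using 2
        field_simp; ring
      rw [a1]
      linear_combination (-(f t * f t ^ ((1 - ρ) * (1 / ρ)))) * a2
    have h1 := hHG t ht hta
    have h2 : h t ^ (1 / ρ) ≤ h s ^ (1 / ρ) :=
      Real.rpow_le_rpow (hhpos t ht' hta).le (hhmono t s ht' hts hsa) (by positivity)
    have h3 : f t * y t ^ (1 / γ) ≤ (Ca + Cb + Cc + Cd) * (H t * Gt f t) := by
      calc _ = Cc * (e / 2 * (f t * y t ^ (1 / γ))) := by rw [hCc]; field_simp
        _ ≤ Cc * (H t * Gt f t) := by gcongr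
        _ ≤ _ := mul_le_mul_of_nonneg_right (by linarith) (hHGnn t)
    rw [e1]
    exact mul_le_mul h3 h2 (Real.rpow_nonneg (hhpos t ht' hta).le _)
      (mul_nonneg (by positivity) (hHGnn t))
  · intro t s ht hts hsa
    have hta := hts.trans_lt hsa
    have ht' := ht01.le.trans ht
    have hyp := hypos t ht' hta
    have hfp := hfpos t ht' hta
    have e1 : y t ^ (1 / ρ) = y t ^ (1 / γ) * y t ^ (1 / γ) * k t ^ (1 / ρ) := by
      simp only [hk]
      rw [← Real.rpow_mul hyp.le, ← Real.rpow_add hyp, ← Real.rpow_add hyp]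
      congr 1; field_simp; ring
    have h1 := hHG t ht hta
    have h2 : k t ^ (1 / ρ) ≤ k s ^ (1 / ρ) :=
      Real.rpow_le_rpow (hkpos t ht' hta).le (hkmono t s ht' hts hsa) (by positivity)
    have h3 : y t ^ (1 / γ) * y t ^ (1 / γ) ≤ (Ca + Cb + Cc + Cd) * (H t * Gt f t) := by
      calc _ ≤ D * f t * y t ^ (1 / γ) := by gcongr; exact hyD t ht' hta
        _ = Cd * (e / 2 * (f t * y t ^ (1 / γ))) := by rw [hCd]; field_simp
        _ ≤ Cd * (H t * Gt f t) := by gcongr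
        _ ≤ _ := mul_le_mul_of_nonneg_right (by linarith) (hHGnn t)
    rw [e1]
    exact mul_le_mul h3 h2 (Real.rpow_nonneg (hkpos t ht' hta).le _)
      (mul_nonneg (by positivity) (hHGnn t))

/-- Continuous and bounded on `Ω`. -/
def BC {n : ℕ} (Ω : Set (EuclideanSpace ℝ (Fin n))) (g : EuclideanSpace ℝ (Fin n) → ℝ) : Prop :=
  ContinuousOn g Ω ∧ ∃ B, ∀ x ∈ Ω, |g x| ≤ B

section BCs
variable {n : ℕ} {Ω : Set (EuclideanSpace ℝ (Fin n))} {g h : EuclideanSpace ℝ (Fin n) → ℝ}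

lemma BC.of_cont (hb : Bornology.IsBounded Ω) (hg : Continuous g) : BC Ω g := by
  refine ⟨hg.continuousOn, ?_⟩
  obtain ⟨B, hB⟩ := hb.isCompact_closure.exists_bound_of_continuousOn hg.continuousOn
  exact ⟨B, fun x hx => hB x (subset_closure hx)⟩

lemma BC.mul (hg : BC Ω g) (hh : BC Ω h) : BC Ω (fun x => g x * h x) := by
  obtain ⟨c1, B1, h1⟩ := hg
  obtain ⟨c2, B2, h2⟩ := hh
  refine ⟨c1.mul c2, B1 * B2, fun x hx => ?_⟩
  rw [abs_mul]
  exact mul_le_mul (h1 x hx) (h2 x hx) (abs_nonneg _) ((abs_nonneg _).trans (h1 x hx))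

lemma BC.add (hg : BC Ω g) (hh : BC Ω h) : BC Ω (fun x => g x + h x) := by
  obtain ⟨c1, B1, h1⟩ := hg
  obtain ⟨c2, B2, h2⟩ := hh
  refine ⟨c1.add c2, B1 + B2, fun x hx => ?_⟩
  exact (abs_add_le _ _).trans (add_le_add (h1 x hx) (h2 x hx))

lemma BC.const (c : ℝ) : BC Ω (fun _ => c) := ⟨continuousOn_const, |c|, fun _ _ => le_rfl⟩

lemma BC.const_mul (c : ℝ) (hg : BC Ω g) : BC Ω (fun x => c * g x) := (BC.const c).mul hg

lemma BC.sub (hg : BC Ω g) (hh : BC Ω h) : BC Ω (fun x => g x - h x) := by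
  have := hg.add (hh.const_mul (-1))
  refine ⟨hg.1.sub hh.1, ?_⟩
  obtain ⟨B, hB⟩ := this.2
  refine ⟨B, fun x hx => ?_⟩
  have := hB x hx
  simp only at this ⊢
  rwa [neg_one_mul, ← sub_eq_add_neg] at this

lemma BC.sq (hg : BC Ω g) : BC Ω (fun x => g x ^ 2) := by
  have := hg.mul hg
  simpa only [pow_two] using this

lemma BC.int (hΩ : IsOpen Ω) (hb : Bornology.IsBounded Ω) (hg : BC Ω g) : IntegrableOn g Ω := by
  obtain ⟨c, B, hB⟩ := hg
  have : IsFiniteMeasure (volume.restrict Ω) := ⟨by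
    rw [Measure.restrict_apply_univ]; exact hb.measure_lt_top⟩
  refine Integrable.of_bound (C := B) ?_ ?_
  · exact c.aestronglyMeasurable hΩ.measurableSet
  · exact (ae_restrict_iff' hΩ.measurableSet).2 (Eventually.of_forall hB)
end BCs

/-- Composite test functions. -/
lemma mkTest {n : ℕ} {Ω : Set (EuclideanSpace ℝ (Fin n))} (hΩ : IsOpen Ω)
    (hb : Bornology.IsBounded Ω) {w : EuclideanSpace ℝ (Fin n) → ℝ} (hw : ContDiff ℝ (⊤ : ℕ∞) w)
    (hw0 : ∀ x ∈ frontier Ω, w x = 0) {Θ : ℝ → ℝ} {δ : ℝ} (hδ : 0 < δ)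
    (hΘ : ∀ x ∈ Ω, ContDiffAt ℝ (⊤ : ℕ∞) Θ (w x)) (h0 : ∀ x ∈ Ω, w x < δ → Θ (w x) = 0) :
    ∃ p : EuclideanSpace ℝ (Fin n) → ℝ, ContDiff ℝ (⊤ : ℕ∞) p ∧ HasCompactSupport p ∧
      (∀ x, x ∉ Ω → p x = 0) ∧ (∀ x, x ∉ Ω → lap p x = 0) ∧ (∀ x ∈ Ω, p x = Θ (w x)) ∧
      (∀ x ∈ Ω, lap p x = deriv (deriv Θ) (w x) * gsq w x + deriv Θ (w x) * lap w x) ∧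
      (∀ x ∈ Ω, ∀ i, pd i p x = deriv Θ (w x) * pd i w x) ∧
      (∀ x, x ∉ Ω → ∀ i, pd i p x = 0) := by
  obtain ⟨hK, hKΩ⟩ := isCompact_superlevel (δ := δ) hb hw.continuous.continuousOn (by
    intro x hx hxΩ
    have : x ∈ frontier Ω := by rw [hΩ.frontier_eq]; exact ⟨hx, hxΩ⟩
    rw [hw0 x this]; exact hδ)
  set K := {x | x ∈ closure Ω ∧ δ ≤ w x} with hKdef
  obtain ⟨hp, hpc⟩ := contDiff_indicator (g := fun x => Θ (w x)) hΩ hK hKΩ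
    (fun x hx => (hΘ x hx).comp x hw.contDiffAt) (by
      intro x hx hxK
      apply h0 x hx
      by_contra hcon
      exact hxK ⟨subset_closure hx, not_lt.1 hcon⟩)
  have hoff : ∀ x, x ∉ K → Ω.indicator (fun x => Θ (w x)) x = 0 := by
    intro x hxK
    by_cases hx : x ∈ Ω
    · rw [Set.indicator_of_mem hx]
      apply h0 x hx
      by_contra hcon
      exact hxK ⟨subset_closure hx, not_lt.1 hcon⟩
    · exact Set.indicator_of_notMem hx _
  have hev : ∀ x ∈ Ω, Ω.indicator (fun x => Θ (w x)) =ᶠ[𝓝 x] fun x => Θ (w x) := by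
    intro x hx
    filter_upwards [hΩ.mem_nhds hx] with y hy
    exact Set.indicator_of_mem hy _
  refine ⟨Ω.indicator (fun x => Θ (w x)), hp, hpc, fun x hx => Set.indicator_of_notMem hx _,
    fun x hx => lap_zero_off hK.isClosed hoff (fun h => hx (hKΩ h)),
    fun x hx => Set.indicator_of_mem hx _, ?_, ?_, ?_⟩
  · intro x hx
    rw [lap_congr (hev x hx)]
    exact lap_comp ((hΘ x hx).of_le two_le_top) (hw.contDiffAt.of_le two_le_top)
  · intro x hx i
    rw [pd_congr (hev x hx)]
    exact pd_comp ((hΘ x hx).differentiableAt top_ne_zero')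
      (hw.contDiffAt.differentiableAt top_ne_zero')
  · intro x hx i
    have : Ω.indicator (fun x => Θ (w x)) =ᶠ[𝓝 x] fun _ => 0 := by
      filter_upwards [hK.isClosed.isOpen_compl.mem_nhds (fun h => hx (hKΩ h))] with y hy
      exact hoff y hy
    rw [pd_congr this]
    simp [pd]

/-- Maximum principle. -/
lemma maxprin {n : ℕ} {Ω : Set (EuclideanSpace ℝ (Fin n))} (hΩ : IsOpen Ω)
    (hb : Bornology.IsBounded Ω) {w : EuclideanSpace ℝ (Fin n) → ℝ}
    (hw : ContinuousOn w (closure Ω)) (hw0 : ∀ x ∈ frontier Ω, w x ≤ 0)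
    (hw2 : ∀ x ∈ Ω, ContDiffAt ℝ 2 w x) (hl : ∀ x ∈ Ω, 0 < w x → 0 < lap w x) :
    ∀ x ∈ Ω, w x ≤ 0 := by
  intro x hx
  by_contra hcon
  push Not at hcon
  obtain ⟨z, hz, hmax⟩ := hb.isCompact_closure.exists_isMaxOn ⟨x, subset_closure hx⟩ hw
  have hwz : 0 < w z := hcon.trans_le (hmax (subset_closure hx))
  have hzΩ : z ∈ Ω := by
    by_contra h
    have : z ∈ frontier Ω := by rw [hΩ.frontier_eq]; exact ⟨hz, h⟩
    linarith [hw0 z this]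
  have hloc : IsLocalMax w z := by
    filter_upwards [hΩ.mem_nhds hzΩ] with y hy
    exact hmax (subset_closure hy)
  linarith [lap_nonpos_of_isLocalMax (hw2 z hzΩ) hloc, hl z hzΩ hwz]

lemma lap_sub {n : ℕ} {g h : EuclideanSpace ℝ (Fin n) → ℝ} {x}
    (hg : ContDiffAt ℝ 2 g x) (hh : ContDiffAt ℝ 2 h x) :
    lap (fun y => g y - h y) x = lap g x - lap h x := by
  unfold lap
  rw [← Finset.sum_sub_distrib]
  refine Finset.sum_congr rfl fun i _ => ?_
  have := iteratedFDeriv_sub_apply (𝕜 := ℝ) (i := 2) hg hh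
  have e : (fun y => g y - h y) = g - h := rfl
  rw [e, this]; rfl

lemma lap_neg {n : ℕ} {g : EuclideanSpace ℝ (Fin n) → ℝ} {x}
    (hg : ContDiffAt ℝ 2 g x) : lap (fun y => - g y) x = - lap g x := by
  have h0 : lap (fun _ : EuclideanSpace ℝ (Fin n) => (0:ℝ)) x = 0 :=
    lap_zero_off (K := ∅) isClosed_empty (fun _ _ => rfl) (by simp)
  have := lap_sub (g := fun _ => 0) contDiffAt_const hg
  simp only [zero_sub] at this
  rw [this, h0, zero_sub]

/-- Data of a semistable solution. -/
structure Sol {n : ℕ} (Ω : Set (EuclideanSpace ℝ (Fin n))) (a : ℝ) (f : ℝ → ℝ) (l : ℝ)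
    (u : EuclideanSpace ℝ (Fin n) → ℝ) : Prop where
  op : IsOpen Ω
  bd : Bornology.IsBounded Ω
  ne : Ω.Nonempty
  nl : NL a f
  lpos : 0 < l
  sm : ContDiff ℝ (⊤ : ℕ∞) u
  nn : ∀ x ∈ Ω, 0 ≤ u x
  lt : ∀ x ∈ Ω, u x < a
  pde : ∀ x ∈ Ω, lap (lap u) x = l * f (u x)
  bu : ∀ x ∈ frontier Ω, u x = 0
  bv : ∀ x ∈ frontier Ω, lap u x = 0
  semi : Semistable Ω l f u

section SolLemmas
variable {n : ℕ} {Ω : Set (EuclideanSpace ℝ (Fin n))} {a : ℝ} {f : ℝ → ℝ} {l : ℝ}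
  {u : EuclideanSpace ℝ (Fin n) → ℝ}

lemma Sol.fpos (S : Sol Ω a f l u) {x} (hx : x ∈ Ω) : 0 < f (u x) :=
  S.nl.f0.trans_le (S.nl.fmono le_rfl (S.nn x hx) (S.lt x hx))

lemma Sol.vsm (S : Sol Ω a f l u) : ContDiff ℝ (⊤ : ℕ∞) (fun x => - lap u x) :=
  (contDiff_lap S.sm).neg

lemma Sol.lapv (S : Sol Ω a f l u) {x} (hx : x ∈ Ω) :
    lap (fun x => - lap u x) x = - (l * f (u x)) := by
  rw [lap_neg ((contDiff_lap S.sm).contDiffAt.of_le two_le_top), S.pde x hx]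

lemma Sol.vpos (S : Sol Ω a f l u) : ∀ x ∈ Ω, 0 < - lap u x := by
  have hc := contDiff_lap S.sm
  have h1 : ∀ x ∈ Ω, lap u x ≤ 0 := by
    apply maxprin S.op S.bd hc.continuous.continuousOn
    · exact fun x hx => (S.bv x hx).le
    · exact fun x _ => hc.contDiffAt.of_le two_le_top
    · intro x hx _
      rw [S.pde x hx]
      exact mul_pos S.lpos (S.fpos hx)
  intro x hx
  have h2 := h1 x hx
  rcases h2.lt_or_eq with h | h
  · linarith
  · exfalso
    have hloc : IsLocalMax (lap u) x := by
      filter_upwards [S.op.mem_nhds hx] with y hy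
      rw [h]; exact h1 y hy
    have := lap_nonpos_of_isLocalMax (hc.contDiffAt.of_le two_le_top) hloc
    rw [S.pde x hx] at this
    linarith [mul_pos S.lpos (S.fpos hx)]

lemma Sol.upos (S : Sol Ω a f l u) : ∀ x ∈ Ω, 0 < u x := by
  intro x hx
  rcases (S.nn x hx).lt_or_eq with h | h
  · exact h
  · exfalso
    have hloc : IsLocalMax (fun y => - u y) x := by
      filter_upwards [S.op.mem_nhds hx] with y hy
      rw [← h]; simpa using S.nn y hy
    have := lap_nonpos_of_isLocalMax (S.sm.neg.contDiffAt.of_le two_le_top) hloc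
    rw [lap_neg (S.sm.contDiffAt.of_le two_le_top)] at this
    linarith [S.vpos x hx]

lemma Sol.tmax (S : Sol Ω a f l u) : ∃ x0 ∈ Ω, ∀ x ∈ Ω, u x ≤ u x0 := by
  obtain ⟨x, hx⟩ := S.ne
  obtain ⟨z, hz, hmax⟩ := S.bd.isCompact_closure.exists_isMaxOn ⟨x, subset_closure hx⟩
    S.sm.continuous.continuousOn
  have hwz : 0 < u z := (S.upos x hx).trans_le (hmax (subset_closure hx))
  refine ⟨z, ?_, fun y hy => hmax (subset_closure hy)⟩
  by_contra h
  have : z ∈ frontier Ω := by rw [S.op.frontier_eq]; exact ⟨hz, h⟩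
  linarith [S.bu z this]

lemma Sol.bcf (S : Sol Ω a f l u) : BC Ω (fun x => f (u x)) := by
  obtain ⟨z, hz, hmax⟩ := S.tmax
  refine ⟨?_, f (u z), ?_⟩
  · intro x hx
    exact ((S.nl.contAt (S.upos x hx) (S.lt x hx)).comp
      S.sm.continuous.continuousAt).continuousWithinAt
  · intro x hx
    rw [abs_of_pos (S.fpos hx)]
    exact S.nl.fmono (S.nn x hx) (hmax x hx) (S.lt z hz)

lemma Sol.ypos (S : Sol Ω a f l u) {x} (hx : x ∈ Ω) : 0 < deriv f (u x) :=
  S.nl.ypos _ ⟨S.upos x hx, S.lt x hx⟩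

lemma Sol.bcy (S : Sol Ω a f l u) : BC Ω (fun x => deriv f (u x)) := by
  obtain ⟨z, hz, hmax⟩ := S.tmax
  refine ⟨?_, deriv f (u z), ?_⟩
  · intro x hx
    exact ((S.nl.smooth_y (S.upos x hx) (S.lt x hx)).continuousAt.comp
      S.sm.continuous.continuousAt).continuousWithinAt
  · intro x hx
    rw [abs_of_pos (S.ypos hx)]
    exact S.nl.ymono ⟨S.upos x hx, S.lt x hx⟩ ⟨S.upos z hz, S.lt z hz⟩ (hmax x hx)

lemma Sol.bcu (S : Sol Ω a f l u) : BC Ω u := BC.of_cont S.bd S.sm.continuous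
lemma Sol.bcv (S : Sol Ω a f l u) : BC Ω (fun x => - lap u x) :=
  BC.of_cont S.bd S.vsm.continuous

/-- `∫ v² ≤ λ ∫ f(u) u`. -/
lemma Sol.v2 (S : Sol Ω a f l u) :
    ∫ x in Ω, (lap u x) ^ 2 ≤ l * ∫ x in Ω, f (u x) * u x := by
  have hv := S.bcv
  have key : ∀ δ > 0, ∫ x in Ω, (lap u x) ^ 2 ≤
      l * (∫ x in Ω, f (u x) * u x) + δ * (2 * ∫ x in Ω, - lap u x) := by
    intro δ hδ
    obtain ⟨η, hηc, hη0, hηd0, hηd1, hηdd, hηnn, hηlow, hηd, hηup⟩ := exists_cutoff δ hδ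
    obtain ⟨p, hp, hpc, hp0, hlp0, hpv, hlp, -, -⟩ := mkTest (w := fun x => - lap u x) (Θ := η)
      S.op S.bd S.vsm (fun x hx => by rw [S.bv x hx, neg_zero]) hδ
      (fun x _ => hηc.contDiffAt) (fun x _ h => hη0 _ h.le)
    have e1 : ∫ x in Ω, p x * lap u x = ∫ x in Ω, lap p x * u x := by
      rw [setIntegral_eq_integral_of_forall_compl_eq_zero,
        setIntegral_eq_integral_of_forall_compl_eq_zero]
      · exact ibp_lap hp S.sm hpc
      · intro x hx; rw [hlp0 x hx, zero_mul]
      · intro x hx; rw [hp0 x hx, zero_mul]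
    have bp : BC Ω p := BC.of_cont S.bd hp.continuous
    have blp : BC Ω (lap p) := BC.of_cont S.bd (contDiff_lap hp).continuous
    have blu : BC Ω (lap u) := BC.of_cont S.bd (contDiff_lap S.sm).continuous
    have i1 := (bp.mul blu).int S.op S.bd
    have i2 := (blp.mul S.bcu).int S.op S.bd
    have i3 := (S.bcf.mul S.bcu).int S.op S.bd
    have i4 := hv.int S.op S.bd
    have i5 := blu.sq.int S.op S.bd
    have h1 : - ∫ x in Ω, lap p x * u x ≤ l * ∫ x in Ω, f (u x) * u x := by
      rw [← integral_neg, ← integral_const_mul]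
      refine setIntegral_mono_on i2.neg (i3.const_mul l) S.op.measurableSet fun x hx => ?_
      rw [hlp x hx, S.lapv hx]
      have a1 := hηd0 (- lap u x)
      have a2 := hηd1 (- lap u x)
      have a3 := hηdd (- lap u x)
      have a4 := gsq_nonneg (fun x => - lap u x) x
      have a5 := S.upos x hx
      have a6 := mul_pos S.lpos (S.fpos hx)
      have a7 : deriv η (- lap u x) * (l * f (u x)) ≤ 1 * (l * f (u x)) :=
        mul_le_mul_of_nonneg_right a2 a6.le
      have a8 := mul_nonneg a3 a4
      nlinarith
    have h2 : ∫ x in Ω, (lap u x) ^ 2 ≤ - (∫ x in Ω, p x * lap u x) + 2 * δ * ∫ x in Ω, - lap u x := by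
      rw [← integral_neg, ← integral_const_mul, ← integral_add i1.fun_neg (i4.const_mul _)]
      refine setIntegral_mono_on i5 (i1.fun_neg.add (i4.const_mul _)) S.op.measurableSet fun x hx => ?_
      have b1 := S.vpos x hx
      have b2 := hηlow _ b1.le
      rw [hpv x hx]
      nlinarith
    rw [e1] at h2
    linarith
  set A := ∫ x in Ω, (lap u x) ^ 2
  set B := l * ∫ x in Ω, f (u x) * u x
  set D := 2 * ∫ x in Ω, - lap u x
  by_contra hcon
  push Not at hcon
  have hk := key ((A - B) / (2 * (|D| + 1))) (div_pos (by linarith) (by positivity))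
  have : (A - B) / (2 * (|D| + 1)) * D ≤ (A - B) / 2 := by
    have hD : D ≤ |D| + 1 := by linarith [le_abs_self D]
    calc _ ≤ (A - B) / (2 * (|D| + 1)) * (|D| + 1) :=
          mul_le_mul_of_nonneg_left hD (div_nonneg (by linarith) (by positivity))
      _ = _ := by field_simp
  linarith

lemma Sol.yu2 (S : Sol Ω a f l u) :
    ∫ x in Ω, deriv f (u x) * u x ^ 2 ≤ ∫ x in Ω, f (u x) * u x := by
  have h1 := S.semi u S.sm S.bu
  have blu : BC Ω (lap u) := BC.of_cont S.bd (contDiff_lap S.sm).continuous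
  have i1 := blu.sq.int S.op S.bd
  have i2 := (S.bcy.mul S.bcu.sq).int S.op S.bd
  have e : ∫ x in Ω, ((lap u x) ^ 2 - l * deriv f (u x) * (u x) ^ 2) =
      (∫ x in Ω, (lap u x) ^ 2) - l * ∫ x in Ω, deriv f (u x) * u x ^ 2 := by
    rw [← integral_const_mul, ← integral_sub i1 (i2.const_mul l)]
    simp only [mul_assoc]
  rw [e] at h1
  have h2 := S.v2
  have : l * ∫ x in Ω, deriv f (u x) * u x ^ 2 ≤ l * ∫ x in Ω, f (u x) * u x := by linarith
  exact le_of_mul_le_mul_left this S.lpos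

/-- `∫ f'(u) v² ≤ λ ∫ f(u)²`. -/
lemma Sol.yv2 (S : Sol Ω a f l u) :
    ∫ x in Ω, deriv f (u x) * (lap u x) ^ 2 ≤ l * ∫ x in Ω, f (u x) ^ 2 := by
  have h1 := S.semi (lap u) (contDiff_lap S.sm) S.bv
  have blu : BC Ω (lap u) := BC.of_cont S.bd (contDiff_lap S.sm).continuous
  have i1 := S.bcf.sq.int S.op S.bd
  have i2 := (S.bcy.mul blu.sq).int S.op S.bd
  have e : ∫ x in Ω, ((lap (lap u) x) ^ 2 - l * deriv f (u x) * (lap u x) ^ 2) =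
      l ^ 2 * (∫ x in Ω, f (u x) ^ 2) - l * ∫ x in Ω, deriv f (u x) * lap u x ^ 2 := by
    rw [← integral_const_mul, ← integral_const_mul, ← integral_sub (i1.const_mul _) (i2.const_mul l)]
    refine setIntegral_congr_fun S.op.measurableSet fun x hx => ?_
    simp only [S.pde x hx]
    ring
  rw [e] at h1
  have : l * ∫ x in Ω, deriv f (u x) * lap u x ^ 2 ≤ l * (l * ∫ x in Ω, f (u x) ^ 2) := by
    linarith
  exact le_of_mul_le_mul_left this S.lpos

/-- `√λ G(u) ≤ v`. -/
lemma Sol.Gle (S : Sol Ω a f l u) : ∀ x ∈ Ω, √l * Gt f (u x) ≤ - lap u x := by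
  have hcl : ∀ x ∈ closure Ω, u x ∈ Set.Ico 0 a := by
    intro x hx
    by_cases h : x ∈ Ω
    · exact ⟨S.nn x h, S.lt x h⟩
    · have : x ∈ frontier Ω := by rw [S.op.frontier_eq]; exact ⟨hx, h⟩
      rw [S.bu x this]; exact ⟨le_rfl, S.nl.ha⟩
  have hsl : 0 < √l := Real.sqrt_pos.2 S.lpos
  have hΘ : ∀ x ∈ Ω, ContDiffAt ℝ 2 (fun t => √l * Gt f t) (u x) := fun x hx =>
    contDiffAt_const.mul (S.nl.contDiffAt_Gt (S.upos x hx) (S.lt x hx))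
  have hu2 : ∀ x, ContDiffAt ℝ 2 u x := fun x => S.sm.contDiffAt.of_le two_le_top
  have hv2 : ∀ x, ContDiffAt ℝ 2 (fun x => - lap u x) x := fun x =>
    S.vsm.contDiffAt.of_le two_le_top
  have h : ∀ x ∈ Ω, √l * Gt f (u x) - - lap u x ≤ 0 := by
    apply maxprin S.op S.bd
    · exact (continuousOn_const.mul
        (S.nl.continuousOn_Gt.comp S.sm.continuous.continuousOn hcl)).sub
          S.vsm.continuous.continuousOn
    · intro x hx
      rw [S.bu x hx, S.bv x hx, Gt_zero]; simp
    · intro x hx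
      exact ((hΘ x hx).comp x (hu2 x)).sub (hv2 x)
    · intro x hx hpos
      have hc : ContDiffAt ℝ 2 (fun x => √l * Gt f (u x)) x := (hΘ x hx).comp x (hu2 x)
      rw [lap_sub hc (hv2 x), S.lapv hx]
      rw [lap_comp (Θ := fun t => √l * Gt f t) (hΘ x hx) (hu2 x)]
      have d1 : deriv (fun t => √l * Gt f t) = fun t => √l * deriv (Gt f) t := by
        funext t; rw [deriv_const_mul_field]
      have d2 : deriv (deriv (fun t => √l * Gt f t)) (u x) = √l * deriv (deriv (Gt f)) (u x) := by
        rw [d1, deriv_const_mul_field]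
      rw [d2, d1]
      have hux := S.upos x hx
      have hua := S.lt x hx
      have g0 := S.nl.Gt_pos hux hua
      have g2 := S.nl.deriv2_Gt hux hua
      have gs := gsq_nonneg u x
      have f0 := S.nl.f0
      have ft := S.nl.ftpos hux hua
      simp only
      rw [(S.nl.hasDerivAt_Gt hux hua).deriv]
      set g := Gt f (u x) with hg
      have k1 : √l * ((f (u x) - f 0) / g) * (- lap u x) ≤ l * (f (u x) - f 0) := by
        have : √l * ((f (u x) - f 0) / g) * (- lap u x) ≤
            √l * ((f (u x) - f 0) / g) * (√l * g) :=
          mul_le_mul_of_nonneg_left (by linarith) (by positivity)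
        refine this.trans (le_of_eq ?_)
        have hll : √l * √l = l := Real.mul_self_sqrt S.lpos.le
        field_simp
        rw [pow_two, hll]
      have k2 : 0 ≤ √l * deriv (deriv (Gt f)) (u x) * gsq u x := by positivity
      have k3 := mul_pos S.lpos f0
      nlinarith
  intro x hx
  linarith [h x hx]
end SolLemmas

section SolLemmas2
variable {n : ℕ} {Ω : Set (EuclideanSpace ℝ (Fin n))} {a : ℝ} {f : ℝ → ℝ} {l : ℝ}
  {u : EuclideanSpace ℝ (Fin n) → ℝ}

lemma lam_bound (hΩ : IsOpen Ω) (hne : Ω.Nonempty) (hf : NL a f) :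
    ∃ Λ, 0 < Λ ∧ ∀ l u, Sol Ω a f l u → l ≤ Λ := by
  obtain ⟨x0, hx0⟩ := hne
  obtain ⟨r, hr, hball⟩ := Metric.isOpen_iff.1 hΩ x0 hx0
  let φ : ContDiffBump x0 := ⟨r / 4, r / 2, by positivity, by linarith⟩
  have hφ : ContDiff ℝ (⊤ : ℕ∞) (φ : EuclideanSpace ℝ (Fin n) → ℝ) := φ.contDiff
  have hφc : HasCompactSupport (φ : EuclideanSpace ℝ (Fin n) → ℝ) := φ.hasCompactSupport
  set K := Metric.closedBall x0 (r / 2) with hK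
  have hKΩ : K ⊆ Ω := (Metric.closedBall_subset_ball (by linarith)).trans hball
  have h0 : ∀ x, x ∉ K → φ x = 0 := by
    intro x hx
    have : x ∉ tsupport φ := by rw [φ.tsupport_eq]; exact hx
    exact image_eq_zero_of_notMem_tsupport this
  have h1 : ∀ x, x ∉ K → lap φ x = 0 := fun x hx =>
    lap_zero_off Metric.isClosed_closedBall h0 hx
  have h2 : ∀ x, x ∉ K → lap (lap φ) x = 0 := fun x hx =>
    lap_zero_off Metric.isClosed_closedBall h1 hx
  have hlc : HasCompactSupport (lap φ) :=
    HasCompactSupport.intro (isCompact_closedBall x0 (r / 2)) h1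
  have hllc : HasCompactSupport (lap (lap φ)) :=
    HasCompactSupport.intro (isCompact_closedBall x0 (r / 2)) h2
  have hl1 := contDiff_lap hφ
  have hl2 := contDiff_lap hl1
  have hI : 0 < ∫ x, φ x := φ.integral_pos
  set I := ∫ x, φ x
  set J := ∫ x, |lap (lap φ) x| with hJ
  have hJ0 : 0 ≤ J := integral_nonneg fun x => abs_nonneg _
  have hf0 := hf.f0
  have ha := hf.ha
  refine ⟨a * J / (f 0 * I) + 1, by positivity, ?_⟩
  intro l u S
  have e1 : ∫ x, φ x * lap (lap u) x = ∫ x, lap (lap φ) x * u x := by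
    rw [ibp_lap hφ (contDiff_lap S.sm) hφc, ibp_lap hl1 S.sm hlc]
  have e2 : l * f 0 * I ≤ ∫ x, φ x * lap (lap u) x := by
    rw [← integral_const_mul]
    apply integral_mono
    · exact (hφ.continuous.integrable_of_hasCompactSupport hφc).const_mul _
    · exact (hφ.continuous.mul (contDiff_lap (contDiff_lap S.sm)).continuous).integrable_of_hasCompactSupport
        hφc.mul_right
    · intro x
      by_cases hx : x ∈ K
      · simp only [S.pde x (hKΩ hx)]
        have := S.nl.fmono le_rfl (S.nn x (hKΩ hx)) (S.lt x (hKΩ hx))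
        have h3 : 0 ≤ φ x := φ.nonneg
        have := mul_le_mul_of_nonneg_left this (mul_nonneg S.lpos.le h3)
        linarith
      · simp [h0 x hx]
  have e3 : ∫ x, lap (lap φ) x * u x ≤ a * J := by
    rw [hJ, ← integral_const_mul]
    apply integral_mono
    · exact (hl2.continuous.mul S.sm.continuous).integrable_of_hasCompactSupport hllc.mul_right
    · exact (hl2.continuous.abs.integrable_of_hasCompactSupport hllc.abs).const_mul _
    · intro x
      by_cases hx : x ∈ K
      · have i1 := S.nn x (hKΩ hx)
        have i2 := S.lt x (hKΩ hx)
        simp only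
        have i3 := le_abs_self (lap (lap φ) x)
        have i4 := abs_nonneg (lap (lap φ) x)
        calc lap (lap φ) x * u x ≤ |lap (lap φ) x| * u x := by gcongr
          _ ≤ |lap (lap φ) x| * a := by gcongr
          _ = _ := mul_comm _ _
      · simp [h2 x hx]
  have : l ≤ a * J / (f 0 * I) := by
    rw [le_div_iff₀ (by positivity)]
    linarith
  linarith

lemma Sol.intf (S : Sol Ω a f l u) {t0 : ℝ} (ht0 : 0 < t0) (ht0a : t0 < a)
    (hy : ∀ t, t0 ≤ t → t < a → 2 * f t ≤ deriv f t * t) :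
    ∫ x in Ω, f (u x) ≤ 3 * f t0 * volume.real Ω := by
  have h1 := S.yu2
  have i1 := (S.bcf.mul S.bcu).int S.op S.bd
  have i2 := (S.bcy.mul S.bcu.sq).int S.op S.bd
  have i0 := S.bcf.int S.op S.bd
  have hft0 : 0 < f t0 := S.nl.f0.trans_le (S.nl.fmono le_rfl ht0.le ht0a)
  have ic : IntegrableOn (fun _ : EuclideanSpace ℝ (Fin n) => 2 * (f t0 * t0)) Ω :=
    integrableOn_const S.bd.measure_lt_top.ne
  have ic2 : IntegrableOn (fun _ : EuclideanSpace ℝ (Fin n) => f t0) Ω :=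
    integrableOn_const S.bd.measure_lt_top.ne
  have h2 : 2 * (∫ x in Ω, f (u x) * u x) ≤
      (∫ x in Ω, deriv f (u x) * u x ^ 2) + ∫ x in Ω, 2 * (f t0 * t0) := by
    rw [← integral_const_mul, ← integral_add i2 ic]
    refine setIntegral_mono_on (i1.const_mul 2) (i2.add ic) S.op.measurableSet fun x hx => ?_
    have hux := S.upos x hx
    rcases le_total t0 (u x) with h | h
    · have := mul_le_mul_of_nonneg_right (hy _ h (S.lt x hx)) hux.le
      have : 0 < f t0 * t0 := by positivity
      nlinarith
    · have k1 := S.nl.fmono hux.le h ht0a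
      have k2 : f (u x) * u x ≤ f t0 * t0 := mul_le_mul k1 h hux.le hft0.le
      have k3 := mul_nonneg (S.ypos hx).le (sq_nonneg (u x))
      linarith
  rw [setIntegral_const, smul_eq_mul] at h2
  have h3 : ∫ x in Ω, f (u x) ≤ (∫ x in Ω, f t0) + (1 / t0) * ∫ x in Ω, f (u x) * u x := by
    rw [← integral_const_mul, ← integral_add ic2 (i1.const_mul _)]
    refine setIntegral_mono_on i0 (ic2.add (i1.const_mul _)) S.op.measurableSet fun x hx => ?_
    have hux := S.upos x hx
    have hfp := S.fpos hx
    rcases le_total t0 (u x) with h | h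
    · have : f (u x) ≤ 1 / t0 * (f (u x) * u x) := by
        rw [one_div, inv_mul_eq_div, le_div_iff₀ ht0]
        gcongr
      linarith
    · have k1 := S.nl.fmono hux.le h ht0a
      have : 0 ≤ 1 / t0 * (f (u x) * u x) := by positivity
      linarith
  rw [setIntegral_const, smul_eq_mul] at h3
  have h4 : ∫ x in Ω, f (u x) * u x ≤ volume.real Ω * (2 * (f t0 * t0)) := by linarith
  have h5 : (1 / t0) * ∫ x in Ω, f (u x) * u x ≤ (1 / t0) * (volume.real Ω * (2 * (f t0 * t0))) := by
    gcongr
  have h6 : (1 / t0) * (volume.real Ω * (2 * (f t0 * t0))) = 2 * f t0 * volume.real Ω := by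
    field_simp
  linarith

lemma NL.exists_delta (hf : NL a f) : ∃ δ, 0 < δ ∧ ∀ t, 0 ≤ t → t < δ → f t ≤ f 0 + 1 := by
  have h := hf.cont 0 ⟨le_rfl, hf.ha⟩
  have h1 : ∀ᶠ t in 𝓝[Set.Ico 0 a] 0, f t < f 0 + 1 := h.eventually (gt_mem_nhds (by linarith))
  rw [eventually_nhdsWithin_iff, Metric.eventually_nhds_iff] at h1
  obtain ⟨ε, hε, hh⟩ := h1
  refine ⟨min ε a, lt_min hε hf.ha, fun t ht htd => ?_⟩
  refine (hh ?_ ⟨ht, htd.trans_le (min_le_right _ _)⟩).le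
  rw [Real.dist_eq, sub_zero, abs_of_nonneg ht]
  exact htd.trans_le (min_le_left _ _)

/-- The test function `η(f(u) - f(0))`. -/
lemma Sol.ptest (S : Sol Ω a f l u) : ∃ p : EuclideanSpace ℝ (Fin n) → ℝ,
    ContDiff ℝ (⊤ : ℕ∞) p ∧ HasCompactSupport p ∧
      (∀ x, x ∉ Ω → p x = 0) ∧ (∀ x, x ∉ Ω → lap p x = 0) ∧ (∀ x, 0 ≤ p x) ∧
      (∀ x ∈ Ω, f (u x) - f 0 - 2 ≤ p x) ∧
      (∀ x ∈ Ω, - lap p x ≤ deriv f (u x) * - lap u x) ∧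
      (∀ x ∈ Ω, f 0 + 2 ≤ f (u x) →
        deriv (deriv f) (u x) * gsq u x ≤ deriv f (u x) * - lap u x + lap p x) := by
  obtain ⟨η, hηc, hη0, hηd0, hηd1, hηdd, hηnn, hηlow, hηd, hηup⟩ := exists_cutoff 1 one_pos
  obtain ⟨δ, hδ, hδf⟩ := S.nl.exists_delta
  obtain ⟨p, hp, hpc, hp0, hlp0, hpv, hlp, -, -⟩ := mkTest (w := u) (Θ := fun t => η (f t - f 0))
      S.op S.bd S.sm S.bu hδ
      (fun x hx => hηc.contDiffAt.comp (u x)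
        ((S.nl.smooth _ ⟨S.upos x hx, S.lt x hx⟩).sub contDiffAt_const))
      (fun x hx h => hη0 _ (by linarith [hδf _ (S.nn x hx) h]))
  have d1 : ∀ t, 0 < t → t < a → HasDerivAt (fun t => η (f t - f 0))
      (deriv η (f t - f 0) * deriv f t) t := by
    intro t ht hta
    have h2 : HasDerivAt η (deriv η (f t - f 0)) (f t - f 0) :=
      (hηc.differentiable top_ne_zero' _).hasDerivAt
    exact h2.comp t ((S.nl.hd ht hta).sub_const (f 0))
  have hηc' : ContDiff ℝ (⊤ : ℕ∞) (deriv η) := (contDiff_infty_iff_deriv.1 hηc).2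
  have d2 : ∀ t, 0 < t → t < a → deriv (deriv (fun t => η (f t - f 0))) t =
      deriv (deriv η) (f t - f 0) * deriv f t * deriv f t +
        deriv η (f t - f 0) * deriv (deriv f) t := by
    intro t ht hta
    have he : deriv (fun t => η (f t - f 0)) =ᶠ[𝓝 t] fun t => deriv η (f t - f 0) * deriv f t := by
      filter_upwards [isOpen_Ioo.mem_nhds (⟨ht, hta⟩ : t ∈ Set.Ioo 0 a)] with s hs
      exact (d1 s hs.1 hs.2).deriv
    rw [he.deriv_eq]
    have h2 : HasDerivAt (deriv η) (deriv (deriv η) (f t - f 0)) (f t - f 0) :=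
      (hηc'.differentiable top_ne_zero' _).hasDerivAt
    have h3 : HasDerivAt (fun t => deriv η (f t - f 0))
      (deriv (deriv η) (f t - f 0) * deriv f t) t :=
      HasDerivAt.comp t (h₂ := deriv η) (h := fun t => f t - f 0) h2 ((S.nl.hd ht hta).sub_const (f 0))
    exact (h3.fun_mul (S.nl.hdy ht hta)).deriv
  have hlp' : ∀ x ∈ Ω, lap p x = (deriv (deriv η) (f (u x) - f 0) * deriv f (u x) * deriv f (u x) +
        deriv η (f (u x) - f 0) * deriv (deriv f) (u x)) * gsq u x +
        deriv η (f (u x) - f 0) * deriv f (u x) * lap u x := by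
    intro x hx
    rw [hlp x hx, d2 _ (S.upos x hx) (S.lt x hx), (d1 _ (S.upos x hx) (S.lt x hx)).deriv]
  refine ⟨p, hp, hpc, hp0, hlp0, ?_, ?_, ?_, ?_⟩
  · intro x
    by_cases hx : x ∈ Ω
    · rw [hpv x hx]; exact hηnn _
    · rw [hp0 x hx]
  · intro x hx
    rw [hpv x hx]
    have := hηlow (f (u x) - f 0) (S.nl.ftpos (S.upos x hx) (S.lt x hx)).le
    linarith
  · intro x hx
    rw [hlp' x hx]
    have a1 := hηd0 (f (u x) - f 0)
    have a2 := hηd1 (f (u x) - f 0)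
    have a3 := hηdd (f (u x) - f 0)
    have a4 := gsq_nonneg u x
    have a5 := S.nl.y2 _ ⟨S.upos x hx, S.lt x hx⟩
    have a6 := S.ypos hx
    have a7 := S.vpos x hx
    have b1 : 0 ≤ (deriv (deriv η) (f (u x) - f 0) * deriv f (u x) * deriv f (u x) +
        deriv η (f (u x) - f 0) * deriv (deriv f) (u x)) * gsq u x := by positivity
    have b2 : deriv η (f (u x) - f 0) * (deriv f (u x) * - lap u x) ≤
        1 * (deriv f (u x) * - lap u x) :=
      mul_le_mul_of_nonneg_right a2 (mul_pos a6 a7).le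
    linarith
  · intro x hx h2
    rw [hlp' x hx, hηd _ (by linarith)]
    have a3 := hηdd (f (u x) - f 0)
    have a4 := gsq_nonneg u x
    have a6 := S.ypos hx
    have b1 : 0 ≤ (deriv (deriv η) (f (u x) - f 0) * deriv f (u x) * deriv f (u x)) * gsq u x := by
      positivity
    linarith

lemma Sol.bcG (S : Sol Ω a f l u) : BC Ω (fun x => Gt f (u x)) := by
  have hsl : 0 < √l := Real.sqrt_pos.2 S.lpos
  obtain ⟨B, hB⟩ := S.bcv.2
  refine ⟨fun x hx => ?_, B / √l, fun x hx => ?_⟩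
  · exact ((S.nl.contDiffAt_Gt (S.upos x hx) (S.lt x hx)).continuousAt.comp
      S.sm.continuous.continuousAt).continuousWithinAt
  · rw [abs_of_nonneg (Gt_nonneg _ _), le_div_iff₀ hsl]
    have := S.Gle x hx
    have h2 := hB x hx
    have h3 := le_abs_self (- lap u x)
    linarith

lemma Sol.intHG (S : Sol Ω a f l u) {t0 C : ℝ} {H : ℝ → ℝ} (ht0 : 0 < t0) (hC : 0 < C)
    (hft0 : ∀ t, t0 ≤ t → t < a → f 0 + 2 ≤ f t)
    (hHs : ∀ t, 0 < t → t < a → ContDiffAt ℝ (⊤ : ℕ∞) H t) (hH0 : ∀ t, 0 < t → t ≤ t0 → H t = 0)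
    (hHnn : ∀ t, 0 ≤ H t) (hHd0 : ∀ t, 0 < t → t ≤ t0 → deriv H t = 0)
    (hHd : ∀ t, t0 ≤ t → t < a → deriv H t ≤ C * deriv (deriv f) t * Gt f t) :
    BC Ω (fun x => H (u x)) ∧
    ∫ x in Ω, H (u x) * Gt f (u x) ≤ C * (f 0 + 2) * ∫ x in Ω, f (u x) := by
  have hsl : 0 < √l := Real.sqrt_pos.2 S.lpos
  have hll : √l * √l = l := Real.mul_self_sqrt S.lpos.le
  obtain ⟨p, hp, hpc, hp0, hlp0, hpnn, hplow, hplap, hpg⟩ := S.ptest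
  obtain ⟨q, hq, hqc, hq0, hlq0, hqv, -, hqd, hqd0⟩ := mkTest (w := u) (Θ := H)
      S.op S.bd S.sm S.bu ht0 (fun x hx => hHs _ (S.upos x hx) (S.lt x hx))
      (fun x hx h => hH0 _ (S.upos x hx) h.le)
  have bq : BC Ω q := BC.of_cont S.bd hq.continuous
  have bH : BC Ω (fun x => H (u x)) := by
    refine ⟨bq.1.congr fun x hx => (hqv x hx).symm, ?_⟩
    obtain ⟨B, hB⟩ := bq.2
    exact ⟨B, fun x hx => by show |H (u x)| ≤ B; rw [← hqv x hx]; exact hB x hx⟩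
  refine ⟨bH, ?_⟩
  have bp : BC Ω p := BC.of_cont S.bd hp.continuous
  have blp : BC Ω (lap p) := BC.of_cont S.bd (contDiff_lap hp).continuous
  have blu : BC Ω (lap u) := BC.of_cont S.bd (contDiff_lap S.sm).continuous
  -- ∫ H v = ∫ H' |∇u|²
  have e1 : ∫ x in Ω, H (u x) * - lap u x = ∫ x in Ω, ∑ i, pd i q x * pd i u x := by
    have h1 := ibp_grad hq S.sm hqc
    have h2 : ∫ x in Ω, H (u x) * - lap u x = - ∫ x in Ω, q x * lap u x := by
      rw [← integral_neg]
      refine setIntegral_congr_fun S.op.measurableSet fun x hx => ?_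
      simp only [hqv x hx]; ring
    rw [h2, setIntegral_eq_integral_of_forall_compl_eq_zero,
      setIntegral_eq_integral_of_forall_compl_eq_zero, h1, neg_neg]
    · intro x hx
      simp [hqd0 x hx]
    · intro x hx; rw [hq0 x hx, zero_mul]
  have bsum : BC Ω (fun x => ∑ i, pd i q x * pd i u x) :=
    BC.of_cont S.bd (continuous_finsetSum _ fun i _ =>
      (contDiff_pd hq).continuous.mul (contDiff_pd S.sm).continuous)
  have i1 := bsum.int S.op S.bd
  have byv := S.bcy.mul blu.sq
  have i2 := byv.int S.op S.bd
  have i3 := (blp.mul blu).int S.op S.bd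
  have i4 := (S.bcf.mul bp).int S.op S.bd
  have i5 := S.bcf.sq.int S.op S.bd
  have i6 := S.bcf.int S.op S.bd
  have h1 : √l * ∫ x in Ω, ∑ i, pd i q x * pd i u x ≤
      C * ((∫ x in Ω, deriv f (u x) * (lap u x) ^ 2) - ∫ x in Ω, lap p x * lap u x) := by
    rw [← integral_sub i2 i3, ← integral_const_mul, ← integral_const_mul]
    refine setIntegral_mono_on (i1.const_mul _) ((i2.sub i3).const_mul C) S.op.measurableSet
      fun x hx => ?_
    have hux := S.upos x hx
    have hua := S.lt x hx
    have hv := S.vpos x hx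
    have hs : ∑ i, pd i q x * pd i u x = deriv H (u x) * gsq u x := by
      unfold gsq
      rw [Finset.mul_sum]
      refine Finset.sum_congr rfl fun i _ => ?_
      rw [hqd x hx i]; ring
    rw [hs]
    have g0 := gsq_nonneg u x
    have k0 := hplap x hx
    have hrhs : deriv f (u x) * lap u x ^ 2 - lap p x * lap u x =
      (deriv f (u x) * - lap u x + lap p x) * - lap u x := by ring
    rw [hrhs]
    rcases le_total t0 (u x) with h | h
    · have k1 := hHd _ h hua
      have k2 := hpg x hx (hft0 _ h hua)
      have k3 := S.Gle x hx
      have k4 := S.nl.y2 _ ⟨hux, hua⟩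
      calc √l * (deriv H (u x) * gsq u x)
          ≤ √l * (C * deriv (deriv f) (u x) * Gt f (u x) * gsq u x) := by gcongr
        _ = C * ((deriv (deriv f) (u x) * gsq u x) * (√l * Gt f (u x))) := by ring
        _ ≤ C * ((deriv (deriv f) (u x) * gsq u x) * - lap u x) := by gcongr
        _ ≤ _ := by gcongr
    · rw [hHd0 _ hux h]
      have : 0 ≤ C * ((deriv f (u x) * - lap u x + lap p x) * - lap u x) :=
        mul_nonneg hC.le (mul_nonneg (by linarith) hv.le)
      simpa using this
  have h2 : ∫ x in Ω, lap p x * lap u x = l * ∫ x in Ω, f (u x) * p x := by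
    rw [← integral_const_mul, setIntegral_eq_integral_of_forall_compl_eq_zero,
      ← ibp_lap hp (contDiff_lap S.sm) hpc]
    · rw [← setIntegral_eq_integral_of_forall_compl_eq_zero (s := Ω)]
      · refine setIntegral_congr_fun S.op.measurableSet fun x hx => ?_
        simp only [S.pde x hx]; ring
      · intro x hx; rw [hp0 x hx, zero_mul]
    · intro x hx; rw [hlp0 x hx, zero_mul]
  have h3 := S.yv2
  have h4 : (∫ x in Ω, f (u x) ^ 2) - (∫ x in Ω, f (u x) * p x) ≤ (f 0 + 2) * ∫ x in Ω, f (u x) := by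
    rw [← integral_sub i5 i4, ← integral_const_mul]
    refine setIntegral_mono_on (i5.sub i4) (i6.const_mul _) S.op.measurableSet fun x hx => ?_
    have k1 := hplow x hx
    have k2 := S.fpos hx
    nlinarith
  have i7 := (bH.mul S.bcG).int S.op S.bd
  have i8 := (bH.mul S.bcv).int S.op S.bd
  have h5 : √l * ∫ x in Ω, H (u x) * Gt f (u x) ≤ ∫ x in Ω, H (u x) * - lap u x := by
    rw [← integral_const_mul]
    refine setIntegral_mono_on (i7.const_mul _) i8 S.op.measurableSet fun x hx => ?_
    have := mul_le_mul_of_nonneg_left (S.Gle x hx) (hHnn (u x))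
    linarith
  rw [e1] at h5
  have h6 : l * ∫ x in Ω, H (u x) * Gt f (u x) ≤ √l * ∫ x in Ω, ∑ i, pd i q x * pd i u x := by
    have := mul_le_mul_of_nonneg_left h5 hsl.le
    rwa [← mul_assoc, hll] at this
  have h7 : (∫ x in Ω, deriv f (u x) * (lap u x) ^ 2) - (∫ x in Ω, lap p x * lap u x) ≤
      l * ((f 0 + 2) * ∫ x in Ω, f (u x)) := by
    rw [h2]
    have := mul_le_mul_of_nonneg_left h4 S.lpos.le
    linarith
  have h8 := mul_le_mul_of_nonneg_left h7 hC.le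
  have h9 : l * ∫ x in Ω, H (u x) * Gt f (u x) ≤ l * (C * (f 0 + 2) * ∫ x in Ω, f (u x)) := by
    linarith
  exact le_of_mul_le_mul_left h9 S.lpos

end SolLemmas2

lemma intbound {n : ℕ} {Ω : Set (EuclideanSpace ℝ (Fin n))} (hΩ : IsOpen Ω)
    (hb : Bornology.IsBounded Ω) {g q : EuclideanSpace ℝ (Fin n) → ℝ} {ρ m C c I hT : ℝ}
    (hρ : 0 < ρ) (hm : 0 ≤ m) (hC : 0 ≤ C) (hc : 0 < c) (hcT : c ≤ hT) (hI0 : 0 ≤ I)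
    (hg : ∀ x ∈ Ω, 0 ≤ g x) (hq : BC Ω q)
    (hI : ∫ x in Ω, q x ≤ I)
    (hp : ∀ x ∈ Ω, g x ^ (1 / ρ) ≤ m ^ (1 / ρ) + C * q x * hT ^ (1 / ρ)) :
    (∫ x in Ω, g x ^ (1 / ρ)) ^ ρ ≤ ((m / c) ^ (1 / ρ) * volume.real Ω + C * I) ^ ρ * hT := by
  have hT0 : 0 < hT := hc.trans_le hcT
  have iq := hq.int hΩ hb
  have ic : IntegrableOn (fun _ : EuclideanSpace ℝ (Fin n) => m ^ (1 / ρ)) Ω :=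
    integrableOn_const hb.measure_lt_top.ne
  have iq2 : IntegrableOn (fun x => C * q x * hT ^ (1 / ρ)) Ω := (iq.const_mul C).mul_const _
  have h1 : ∫ x in Ω, g x ^ (1 / ρ) ≤ ∫ x in Ω, (m ^ (1 / ρ) + C * q x * hT ^ (1 / ρ)) := by
    apply integral_mono_of_nonneg
    · exact (ae_restrict_iff' hΩ.measurableSet).2 (Eventually.of_forall fun x hx =>
        Real.rpow_nonneg (hg x hx) _)
    · exact ic.add iq2
    · exact (ae_restrict_iff' hΩ.measurableSet).2 (Eventually.of_forall hp)
  rw [integral_add ic iq2, setIntegral_const, smul_eq_mul, integral_mul_const,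
    integral_const_mul] at h1
  have hV : 0 ≤ volume.real Ω := measureReal_nonneg
  have h2 : m ^ (1 / ρ) ≤ (m / c) ^ (1 / ρ) * hT ^ (1 / ρ) := by
    rw [← Real.mul_rpow (by positivity) hT0.le]
    apply Real.rpow_le_rpow hm _ (by positivity)
    rw [div_mul_eq_mul_div, le_div_iff₀ hc]
    gcongr
  have h3 : ∫ x in Ω, g x ^ (1 / ρ) ≤
      ((m / c) ^ (1 / ρ) * volume.real Ω + C * I) * hT ^ (1 / ρ) := by
    refine h1.trans ?_
    rw [add_mul]
    apply add_le_add
    · calc _ ≤ volume.real Ω * ((m / c) ^ (1 / ρ) * hT ^ (1 / ρ)) := by gcongr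
        _ = _ := by ring
    · gcongr
  have h0 : 0 ≤ ∫ x in Ω, g x ^ (1 / ρ) :=
    setIntegral_nonneg hΩ.measurableSet fun x hx => Real.rpow_nonneg (hg x hx) _
  calc _ ≤ (((m / c) ^ (1 / ρ) * volume.real Ω + C * I) * hT ^ (1 / ρ)) ^ ρ :=
        Real.rpow_le_rpow h0 h3 hρ.le
    _ = _ := by
        rw [Real.mul_rpow (by positivity) (by positivity), ← Real.rpow_mul hT0.le,
          one_div_mul_cancel hρ.ne', Real.rpow_one]

lemma int_scale {n : ℕ} {Ω : Set (EuclideanSpace ℝ (Fin n))} (hΩ : IsOpen Ω)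
    {g : EuclideanSpace ℝ (Fin n) → ℝ} {ρ b : ℝ}
    (hρ : 0 < ρ) (hb : 0 ≤ b) (hg : ∀ x ∈ Ω, 0 ≤ g x) :
    (∫ x in Ω, (b * g x) ^ (1 / ρ)) ^ ρ = b * (∫ x in Ω, g x ^ (1 / ρ)) ^ ρ := by
  have h0 : 0 ≤ ∫ x in Ω, g x ^ (1 / ρ) :=
    setIntegral_nonneg hΩ.measurableSet fun x hx => Real.rpow_nonneg (hg x hx) _
  have : ∫ x in Ω, (b * g x) ^ (1 / ρ) = b ^ (1 / ρ) * ∫ x in Ω, g x ^ (1 / ρ) := by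
    rw [← integral_const_mul]
    exact setIntegral_congr_fun hΩ.measurableSet fun x hx => Real.mul_rpow hb (hg x hx)
  rw [this, Real.mul_rpow (by positivity) h0, ← Real.rpow_mul hb, one_div_mul_cancel hρ.ne',
    Real.rpow_one]

lemma tau_choice {n : ℕ} (hn1 : 1 ≤ n) {a : ℝ} {f : ℝ → ℝ} (hf : NL a f)
    (hτ0 : 0 < tauPlus (a : EReal) f) (hτ2 : tauPlus (a : EReal) f < 2)
    (hn : (n : ℝ) < 8 / tauPlus (a : EReal) f) :
    ∃ γ ρ : ℝ, 0 < γ ∧ γ < 2 ∧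
      (∀ᶠ t in 𝓝[<] a, f t * deriv (deriv f) t ≤ γ * deriv f t ^ 2) ∧
      γ / 4 < ρ ∧ ρ < 1 / 2 ∧ ρ < γ / 3 ∧ ρ * n < 2 := by
  have hnpos : (0:ℝ) < n := by exact_mod_cast hn1
  set τ := tauPlus (a : EReal) f with hτ
  have hτn : τ < 8 / n := by
    rw [lt_div_iff₀ hτ0] at hn
    rw [lt_div_iff₀ hnpos]; linarith
  obtain ⟨γ, hγ1, hγ2⟩ := exists_between (lt_min hτ2 hτn)
  have hγ0 := hτ0.trans hγ1
  have hγn : γ * n < 8 := by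
    have := hγ2.trans_le (min_le_right _ _)
    rwa [lt_div_iff₀ hnpos] at this
  have hγ2' : γ < 2 := hγ2.trans_le (min_le_left _ _)
  have hm : γ / 4 < min (min (1 / 2) (γ / 3)) (2 / n) := by
    refine lt_min (lt_min (by linarith) (by linarith)) ?_
    rw [lt_div_iff₀ hnpos]; linarith
  obtain ⟨ρ, hρ1, hρ2⟩ := exists_between hm
  refine ⟨γ, ρ, hγ0, hγ2', ?_, hρ1, hρ2.trans_le ((min_le_left _ _).trans (min_le_left _ _)),
    hρ2.trans_le ((min_le_left _ _).trans (min_le_right _ _)), ?_⟩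
  · have hτdef : τ = sInf {b | ∀ᶠ t in 𝓝[<] a,
        f t * deriv (deriv f) t / (deriv f t) ^ 2 ≤ b} := by
      rw [hτ, tauPlus, afFilter_coe, Filter.limsup_eq]
    have hne : {b | ∀ᶠ t in 𝓝[<] a,
        f t * deriv (deriv f) t / (deriv f t) ^ 2 ≤ b}.Nonempty := by
      by_contra h
      rw [Set.not_nonempty_iff_eq_empty] at h
      rw [h, Real.sInf_empty] at hτdef
      linarith
    rw [hτdef] at hγ1
    obtain ⟨b, hb, hbγ⟩ := exists_lt_of_csInf_lt hne hγ1
    have hI : ∀ᶠ t in 𝓝[<] a, t ∈ Set.Ioo 0 a := Ioo_mem_nhdsLT hf.ha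
    filter_upwards [hb, hI] with t ht htI
    have hy := hf.ypos t htI
    rw [div_le_iff₀ (by positivity)] at ht
    have : b * deriv f t ^ 2 ≤ γ * deriv f t ^ 2 := by gcongr
    linarith
  · have := hρ2.trans_le (min_le_right _ _)
    rwa [lt_div_iff₀ hnpos] at this

/-- The uniform bound on `f(u)` for semistable solutions. -/
lemma uniform_bound {n : ℕ} (hn1 : 1 ≤ n) {Ω : Set (EuclideanSpace ℝ (Fin n))} (hΩ : GoodDomain Ω)
    {a : ℝ} {f : ℝ → ℝ} (hf : NL a f) {γ ρ : ℝ} (hγ0 : 0 < γ) (hγ2 : γ < 2)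
    (hev : ∀ᶠ t in 𝓝[<] a, f t * deriv (deriv f) t ≤ γ * deriv f t ^ 2)
    (hρ0 : γ / 4 < ρ) (hρ1 : ρ < 1 / 2) (hρ2 : ρ < γ / 3) (hρn : ρ * n < 2) :
    ∃ M, ∀ l u, Sol Ω a f l u → ∀ x ∈ Ω, f (u x) ≤ M := by
  obtain ⟨hop, hbd, hne⟩ := hΩ
  have hρ : 0 < ρ := by linarith
  obtain ⟨t0, t1, c, C, κ, H, h, k, ht0, ht01, ht1a, hc, hC, hκ, hft0, hy2, hHs, hH0, hHnn, hHd0,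
    hHd, hch, hck, hhk, hfh, hyk⟩ := hf.real_part hγ0 hγ2 hev hρ0 hρ1 hρ2
  obtain ⟨Λ, hΛ, hlam⟩ := lam_bound hop hne hf
  obtain ⟨Cp, hCp, hpot⟩ := potential hn1 hop hbd hρ (by linarith) hρn
  have ht1 : 0 < t1 := ht0.trans ht01
  have hf0 := hf.f0
  have hft0p : 0 < f t0 := hf0.trans_le (hf.fmono le_rfl ht0.le (ht01.trans ht1a))
  have hft1p : 0 < f t1 := hf0.trans_le (hf.fmono le_rfl ht1.le ht1a)
  have hyt1p : 0 < deriv f t1 := hf.ypos _ ⟨ht1, ht1a⟩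
  obtain ⟨V, hV⟩ : ∃ V, V = volume.real Ω := ⟨_, rfl⟩
  have hV0 : 0 ≤ V := by rw [hV]; exact measureReal_nonneg
  obtain ⟨I, hI⟩ : ∃ I, I = C * (f 0 + 2) * (3 * f t0 * V) := ⟨_, rfl⟩
  have hI0 : 0 ≤ I := by rw [hI]; positivity
  obtain ⟨A1, hA1⟩ : ∃ A1, A1 = ((f t1 / c) ^ (1 / ρ) * V + C * I) ^ ρ := ⟨_, rfl⟩
  obtain ⟨A2, hA2⟩ : ∃ A2, A2 = ((deriv f t1 / c) ^ (1 / ρ) * V + C * I) ^ ρ := ⟨_, rfl⟩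
  have hA10 : 0 ≤ A1 := by rw [hA1]; positivity
  have hA20 : 0 ≤ A2 := by rw [hA2]; positivity
  obtain ⟨B1, hB1⟩ : ∃ B1, B1 = 2 / c + Cp * Λ * A1 := ⟨_, rfl⟩
  have hB10 : 0 ≤ B1 := by rw [hB1]; positivity
  obtain ⟨B3, hB3⟩ : ∃ B3, B3 = (f 0 + 2) / c ^ 2 + Cp * B1 * A2 := ⟨_, rfl⟩
  have hB30 : 0 ≤ B3 := by rw [hB3]; positivity
  refine ⟨max (f t1) ((B3 * C) ^ (1 / κ)), fun l u S => ?_⟩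
  obtain ⟨x0, hx0, hmax⟩ := S.tmax
  have hTa := S.lt x0 hx0
  suffices hT : f (u x0) ≤ max (f t1) ((B3 * C) ^ (1 / κ)) from fun x hx =>
    (S.nl.fmono (S.nn x hx) (hmax x hx) hTa).trans hT
  rcases lt_or_ge (u x0) t1 with hlt | hge
  · exact (S.nl.fmono (S.nn x0 hx0) hlt.le ht1a).trans (le_max_left _ _)
  refine le_trans ?_ (le_max_right _ _)
  obtain ⟨T, hT⟩ : ∃ T, T = u x0 := ⟨_, rfl⟩
  rw [← hT] at hge hTa hmax ⊢
  have chT := hch T hge hTa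
  have ckT := hck T hge hTa
  have hhT : 0 < h T := hc.trans_le chT
  have hkT : 0 < k T := hc.trans_le ckT
  have hfT : 0 < f T := by rw [hT]; exact S.fpos hx0
  -- integral bounds
  have hintf := S.intf ht0 (ht01.trans ht1a) hy2
  obtain ⟨bH, hHG⟩ := S.intHG ht0 hC hft0 hHs hH0 hHnn hHd0 hHd
  have hHGI : ∫ x in Ω, H (u x) * Gt f (u x) ≤ I := by
    refine hHG.trans ?_
    rw [hI, hV]
    gcongr
  have bHG : BC Ω (fun x => H (u x) * Gt f (u x)) := bH.mul S.bcG
  have hq0 : ∀ x, 0 ≤ H (u x) * Gt f (u x) := fun x => mul_nonneg (hHnn _) (Gt_nonneg _ _)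
  have hin1 : (∫ x in Ω, f (u x) ^ (1 / ρ)) ^ ρ ≤ A1 * h T := by
    rw [hA1, hV]
    refine intbound (q := fun x => H (u x) * Gt f (u x)) hop hbd hρ hft1p.le hC.le hc chT hI0
      (fun x hx => (S.fpos hx).le) bHG hHGI fun x hx => ?_
    rcases lt_or_ge (u x) t1 with h1 | h1
    · have k1 : f (u x) ^ (1 / ρ) ≤ f t1 ^ (1 / ρ) :=
        Real.rpow_le_rpow (S.fpos hx).le (S.nl.fmono (S.nn x hx) h1.le ht1a) (by positivity)
      have k2 : 0 ≤ C * (H (u x) * Gt f (u x)) * h T ^ (1 / ρ) :=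
        mul_nonneg (mul_nonneg hC.le (hq0 x)) (Real.rpow_nonneg hhT.le _)
      linarith
    · have k1 := hfh (u x) T h1 (hmax x hx) hTa
      have k2 : 0 ≤ f t1 ^ (1 / ρ) := by positivity
      linarith
  have hin2 : (∫ x in Ω, deriv f (u x) ^ (1 / ρ)) ^ ρ ≤ A2 * k T := by
    rw [hA2, hV]
    refine intbound (q := fun x => H (u x) * Gt f (u x)) hop hbd hρ hyt1p.le hC.le hc ckT hI0
      (fun x hx => (S.ypos hx).le) bHG hHGI fun x hx => ?_
    rcases lt_or_ge (u x) t1 with h1 | h1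
    · have k1 : deriv f (u x) ^ (1 / ρ) ≤ deriv f t1 ^ (1 / ρ) :=
        Real.rpow_le_rpow (S.ypos hx).le
          (S.nl.ymono ⟨S.upos x hx, S.lt x hx⟩ ⟨ht1, ht1a⟩ h1.le) (by positivity)
      have k2 : 0 ≤ C * (H (u x) * Gt f (u x)) * k T ^ (1 / ρ) :=
        mul_nonneg (mul_nonneg hC.le (hq0 x)) (Real.rpow_nonneg hkT.le _)
      linarith
    · have k1 := hyk (u x) T h1 (hmax x hx) hTa
      have k2 : 0 ≤ deriv f t1 ^ (1 / ρ) := by positivity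
      linarith
  -- bound on `v = -Δu`
  have hv : ∀ x ∈ Ω, - lap u x ≤ B1 * h T := by
    obtain ⟨η, hηc, hη0, hηd0, hηd1, hηdd, hηnn, hηlow, hηd, hηup⟩ := exists_cutoff 1 one_pos
    obtain ⟨p, hp, hpc, hp0, hlp0, hpv, hlp, -, -⟩ := mkTest (w := fun x => - lap u x) (Θ := η)
      S.op S.bd S.vsm (fun x hx => by rw [S.bv x hx, neg_zero]) one_pos
      (fun x _ => hηc.contDiffAt) (fun x _ h => hη0 _ h.le)
    have bg := S.bcf.const_mul Λ
    have hP := hpot p (fun x => Λ * f (u x)) hp hpc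
      (fun x => by
        by_cases hx : x ∈ Ω
        · rw [hpv x hx]; exact hηnn _
        · rw [hp0 x hx])
      hp0 hlp0 bg.1 (fun x hx => mul_nonneg hΛ.le (S.fpos hx).le)
      (by
        obtain ⟨B, hB⟩ := bg.2
        exact ⟨B, fun x hx => (le_abs_self _).trans (hB x hx)⟩)
      (fun x hx => by
        rw [hlp x hx, S.lapv hx]
        have a1 := hηd0 (- lap u x)
        have a2 := hηd1 (- lap u x)
        have a3 := hηdd (- lap u x)
        have a4 := gsq_nonneg (fun x => - lap u x) x
        have a5 := S.fpos hx
        have a6 := mul_nonneg a3 a4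
        have a7 : l * f (u x) ≤ Λ * f (u x) := by
          have := hlam l u S
          gcongr
        have a8 : deriv η (- lap u x) * (l * f (u x)) ≤ 1 * (l * f (u x)) :=
          mul_le_mul_of_nonneg_right a2 (mul_pos S.lpos a5).le
        linarith)
    intro x hx
    have h1 := hP x
    rw [int_scale hop hρ hΛ.le (fun x hx => (S.fpos hx).le), hpv x hx] at h1
    have h2 := hηlow (- lap u x) (S.vpos x hx).le
    have h3 : Cp * (Λ * (∫ x in Ω, f (u x) ^ (1 / ρ)) ^ ρ) ≤ Cp * (Λ * (A1 * h T)) := by gcongr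
    have h4 : 2 ≤ 2 / c * h T := by
      rw [div_mul_eq_mul_div, le_div_iff₀ hc]; linarith
    have h5 : B1 * h T = 2 / c * h T + Cp * (Λ * (A1 * h T)) := by rw [hB1]; ring
    linarith
  -- bound on `f(u)`
  have hfin : f T - f 0 - 2 ≤ Cp * B1 * A2 * (h T * k T) := by
    obtain ⟨p, hp, hpc, hp0, hlp0, hpnn, hplow, hplap, -⟩ := S.ptest
    have hb0 : 0 ≤ B1 * h T := mul_nonneg hB10 hhT.le
    have bg := S.bcy.const_mul (B1 * h T)
    have hP := hpot p (fun x => (B1 * h T) * deriv f (u x)) hp hpc hpnn hp0 hlp0 bg.1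
      (fun x hx => mul_nonneg hb0 (S.ypos hx).le)
      (by
        obtain ⟨B, hB⟩ := bg.2
        exact ⟨B, fun x hx => (le_abs_self _).trans (hB x hx)⟩)
      (fun x hx => by
        have h1 := hplap x hx
        have h2 := mul_le_mul_of_nonneg_left (hv x hx) (S.ypos hx).le
        linarith)
    have h1 := hP x0
    rw [int_scale hop hρ hb0 (fun x hx => (S.ypos hx).le)] at h1
    have h2 := hplow x0 hx0
    rw [← hT] at h2
    have h3 : Cp * ((B1 * h T) * (∫ x in Ω, deriv f (u x) ^ (1 / ρ)) ^ ρ) ≤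
        Cp * ((B1 * h T) * (A2 * k T)) := by gcongr
    linarith
  have h1 : f 0 + 2 ≤ (f 0 + 2) / c ^ 2 * (h T * k T) := by
    rw [div_mul_eq_mul_div, le_div_iff₀ (by positivity)]
    have : c ^ 2 ≤ h T * k T := by rw [sq]; gcongr
    gcongr
  have h2 : f T ≤ B3 * (h T * k T) := by
    have : B3 * (h T * k T) = (f 0 + 2) / c ^ 2 * (h T * k T) + Cp * B1 * A2 * (h T * k T) := by
      rw [hB3]; ring
    linarith
  have h3 : f T ≤ B3 * C * f T ^ (1 - κ) := by
    have := mul_le_mul_of_nonneg_left (hhk T hge hTa) hB30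
    linarith
  have h4 : f T ^ κ ≤ B3 * C := by
    rw [Real.rpow_sub hfT, Real.rpow_one, mul_div_assoc', le_div_iff₀ (by positivity)] at h3
    have h5 : f T * f T ^ κ ≤ f T * (B3 * C) := by linarith
    exact le_of_mul_le_mul_left h5 hfT
  calc f T = (f T ^ κ) ^ (1 / κ) := by
        rw [← Real.rpow_mul hfT.le, mul_one_div_cancel hκ.ne', Real.rpow_one]
    _ ≤ _ := Real.rpow_le_rpow (by positivity) h4 (by positivity)

/-- **Lemma 2.5.** For a singular nonlinearity `f` satisfying (H) with `0 < τ₊ < 2`, any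
sequence of semistable solutions of `(N_{λ_m})` satisfies `sup_m ‖u_m‖_{L^∞(Ω)} < a_f`
whenever `n < 8/τ₊`. -/
theorem statement11 {n : ℕ} (Ω : Set (EuclideanSpace ℝ (Fin n))) (hΩ : GoodDomain Ω)
    (a : ℝ) (ha : 0 < a) (f : ℝ → ℝ) (hf : HypH (a : EReal) f)
    (hτ0 : 0 < tauPlus (a : EReal) f) (hτ2 : tauPlus (a : EReal) f < 2)
    (lam : ℕ → ℝ) (hlam : ∀ m, 0 < lam m)
    (u : ℕ → EuclideanSpace ℝ (Fin n) → ℝ)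
    (hsol : ∀ m, Solves Ω (a : EReal) (lam m) f (u m))
    (hsemi : ∀ m, Semistable Ω (lam m) f (u m))
    (hn : (n : ℝ) < 8 / tauPlus (a : EReal) f) :
    ∃ C : ℝ, C < a ∧ ∀ m, ∀ x ∈ Ω, u m x ≤ C := by
  have hS : ∀ m, Sol Ω a f (lam m) (u m) := fun m => by
    obtain ⟨h1, h2, h3, h4, h5⟩ := hsol m
    exact ⟨hΩ.1, hΩ.2.1, hΩ.2.2, hf.toNL ha, hlam m, h1, fun x hx => (h2 x hx).1,
      fun x hx => EReal.coe_lt_coe_iff.1 (h2 x hx).2, h3, h4, h5, hsemi m⟩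
  have hNL := hf.toNL ha
  rcases Nat.eq_zero_or_pos n with h0 | hn1
  · exfalso
    subst h0
    obtain ⟨x, hx⟩ := hΩ.2.2
    have h1 := (hS 0).pde x hx
    have h2 := mul_pos (hlam 0) ((hS 0).fpos hx)
    rw [← h1] at h2
    simp [lap] at h2
  obtain ⟨γ, ρ, hγ0, hγ2, hev, hρ0, hρ1, hρ2, hρn⟩ := tau_choice hn1 hNL hτ0 hτ2 hn
  obtain ⟨M, hM⟩ := uniform_bound hn1 hΩ hNL hγ0 hγ2 hev hρ0 hρ1 hρ2 hρn
  obtain ⟨b, hb, hsub⟩ :=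
    (mem_nhdsLT_iff_exists_Ioo_subset).1 (hNL.blow.eventually_gt_atTop M)
  refine ⟨b, hb, fun m x hx => ?_⟩
  by_contra hlt
  have h1 : M < f (u m x) := hsub ⟨lt_of_not_ge hlt, (hS m).lt x hx⟩
  exact absurd (hM _ _ (hS m) x hx) (not_le.2 h1)

end
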